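/- arXiv:2512.12988 — 4 statements merged into one kernel-verified Lean document; each statement's English description precedes it below -/
import Mathlib

section
/- Let r, σ > 0. For any ℓ ≥ 1, k ∈ [ℓ] and j ≥ ℓ, Σ_{K ∈ 𝒦_j} det(U_K^{(−k)})² ≤ (e^{5r²/(4σ²)} 4^ℓ (2√2 σ/r)^j √(j!))² · det(A). -/
open MeasureTheory

/-- Physicists' Hermite polynomials, via the standard three-term recurrence. -/
noncomputable def hermiteP : ℕ → ℝ → ℝ
  | 0 => fun _ => 1
  | 1 => fun x => 2 * x
  | n + 2 => fun x => 2 * x * hermiteP (n + 1) x - 2 * (n + 1) * hermiteP n x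

/-- Scaled Hermite function `ψ_{j,μ,σ}`. -/
noncomputable def psiH (j : ℕ) (μ σ : ℝ) (x : ℝ) : ℝ :=
  (-1 : ℝ) ^ j * (Real.sqrt (2 ^ j * (Nat.factorial j : ℝ) * σ * Real.sqrt Real.pi))⁻¹ *
    hermiteP j ((x - μ) / σ) * Real.exp (-(x - μ) ^ 2 / (2 * σ ^ 2))

/-- `L²(ℝ)` inner product. -/
noncomputable def ip (f g : ℝ → ℝ) : ℝ := ∫ x, f x * g x

/-- The `2ℓ × 2ℓ` Gram matrix `A` with centers `0` and `r`. -/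
noncomputable def matA (ℓ : ℕ) (r σ : ℝ) :
    Matrix (Fin 2 × Fin ℓ) (Fin 2 × Fin ℓ) ℝ :=
  Matrix.of fun p q =>
    ip (psiH p.2 (if p.1 = 0 then 0 else r) σ) (psiH q.2 (if q.1 = 0 then 0 else r) σ)

/-- For `ℓ = m + 1`, a tuple `a : Fin m → ℕ` of row indices and `k ∈ [ℓ]`, the
`(ℓ−1) × (ℓ−1)` matrix `U_K^{(−k)}` with `(i,j)`-entry `⟨ψ_{c_j,r,σ}, ψ_{a_i,0,σ}⟩`,
`c_j` ranging over `[ℓ] \ {k}` in increasing order. -/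
noncomputable def UKminus (m : ℕ) (σ r : ℝ) (k : Fin (m + 1)) (a : Fin m → ℕ) :
    Matrix (Fin m) (Fin m) ℝ :=
  Matrix.of fun i j => ip (psiH (k.succAbove j) r σ) (psiH (a i) 0 σ)


lemma herm_rec (n : ℕ) (x : ℝ) :
    hermiteP (n + 1) x = 2 * x * hermiteP n x - 2 * n * hermiteP (n - 1) x := by
  cases n with
  | zero => simp [hermiteP]
  | succ n => simp [hermiteP]

lemma herm_deriv (n : ℕ) : ∀ x : ℝ, HasDerivAt (hermiteP n) (2 * n * hermiteP (n - 1) x) x := by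
  induction n using Nat.strong_induction_on with
  | _ n ih =>
    intro x
    match n, ih with
    | 0, _ =>
      have : hermiteP 0 = fun _ => (1 : ℝ) := by funext y; simp [hermiteP]
      rw [this]
      simpa using hasDerivAt_const x (1 : ℝ)
    | 1, _ =>
      have : hermiteP 1 = fun y : ℝ => 2 * y := by funext y; simp [hermiteP]
      rw [this]
      simpa [hermiteP] using (hasDerivAt_id x).const_mul (2 : ℝ)
    | n + 2, ih =>
      have h1 := ih (n + 1) (by omega) x
      have h0 := ih n (by omega) x
      have : hermiteP (n + 2) = fun y : ℝ =>
          2 * y * hermiteP (n + 1) y - 2 * (n + 1) * hermiteP n y := by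
        funext y; simp [hermiteP]
      rw [this]
      have h2 := (((hasDerivAt_id x).const_mul (2 : ℝ)).mul h1).sub
        (h0.const_mul (2 * ((n : ℝ) + 1)))
      refine h2.congr_deriv ?_
      have hr := herm_rec n x
      simp only [Nat.add_sub_cancel, show n + 2 - 1 = n + 1 by omega, id]
      push_cast
      rw [hr]
      ring

lemma herm_poly (n : ℕ) : ∃ p : Polynomial ℝ, ∀ x, hermiteP n x = p.eval x := by
  induction n using Nat.strong_induction_on with
  | _ n ih =>
    match n, ih with
    | 0, _ => exact ⟨1, fun x => by simp [hermiteP]⟩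
    | n + 1, ih =>
      obtain ⟨p, hp⟩ := ih n (by omega)
      obtain ⟨q, hq⟩ := ih (n - 1) (by omega)
      refine ⟨Polynomial.C 2 * Polynomial.X * p - Polynomial.C (2 * (n : ℝ)) * q, fun x => ?_⟩
      rw [herm_rec, hp, hq]
      simp

lemma poly_gauss_integrable0 (b : ℝ) (hb : 0 < b) (p : Polynomial ℝ) :
    Integrable (fun x : ℝ => p.eval x * Real.exp (-b * x ^ 2)) := by
  induction p using Polynomial.induction_on' with
  | add p q hp hq =>
    refine (hp.add hq).congr (Filter.Eventually.of_forall fun x => ?_)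
    simp [add_mul]
  | monomial n a =>
    have h := (integrable_rpow_mul_exp_neg_mul_sq hb (s := (n : ℝ))
      (by have : (0 : ℝ) ≤ n := Nat.cast_nonneg n
          linarith)).const_mul a
    simpa [Polynomial.eval_monomial, mul_assoc] using h

lemma poly_gauss_integrable (b s : ℝ) (hb : 0 < b) (p : Polynomial ℝ) :
    Integrable (fun x : ℝ => p.eval x * Real.exp (-b * (x - s) ^ 2)) := by
  have h := (poly_gauss_integrable0 b hb (p.comp (Polynomial.X + Polynomial.C s))).comp_sub_right s
  simpa using h

noncomputable def EE (σ μ ν x : ℝ) : ℝ :=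
  Real.exp (-(x - μ) ^ 2 / (2 * σ ^ 2)) * Real.exp (-(x - ν) ^ 2 / (2 * σ ^ 2))

lemma EE_eq (σ μ ν x : ℝ) (hσ : 0 < σ) :
    EE σ μ ν x = Real.exp (-(μ - ν) ^ 2 / (4 * σ ^ 2)) *
      Real.exp (-(1 / σ ^ 2) * (x - (μ + ν) / 2) ^ 2) := by
  unfold EE
  rw [← Real.exp_add, ← Real.exp_add]
  congr 1
  field_simp
  ring

lemma EE_int (σ μ ν : ℝ) (hσ : 0 < σ) :
    ∫ x, EE σ μ ν x = Real.exp (-(μ - ν) ^ 2 / (4 * σ ^ 2)) * (σ * Real.sqrt Real.pi) := by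
  simp_rw [EE_eq σ μ ν _ hσ]
  rw [integral_const_mul]
  congr 1
  rw [integral_sub_right_eq_self (fun x : ℝ => Real.exp (-(1 / σ ^ 2) * x ^ 2)) ((μ + ν) / 2),
    integral_gaussian]
  rw [show Real.pi / (1 / σ ^ 2) = σ ^ 2 * Real.pi by field_simp, Real.sqrt_mul (by positivity),
    Real.sqrt_sq hσ.le]

lemma EE_deriv (σ μ ν x : ℝ) (hσ : 0 < σ) :
    HasDerivAt (EE σ μ ν) (-((x - μ) / σ + (x - ν) / σ) / σ * EE σ μ ν x) x := by
  have h (m : ℝ) : HasDerivAt (fun x : ℝ => Real.exp (-(x - m) ^ 2 / (2 * σ ^ 2)))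
      (Real.exp (-(x - m) ^ 2 / (2 * σ ^ 2)) * (-(x - m) / σ ^ 2)) x := by
    refine HasDerivAt.exp ?_
    have := ((((hasDerivAt_id x).sub_const m).pow 2).neg.div_const (2 * σ ^ 2))
    refine this.congr_deriv ?_
    simp
    field_simp
    ring
  refine ((h μ).mul (h ν)).congr_deriv ?_
  unfold EE
  field_simp
  ring

noncomputable def hJ (σ μ ν : ℝ) (c a : ℕ) : ℝ :=
  ∫ x, hermiteP c ((x - μ) / σ) * hermiteP a ((x - ν) / σ) * EE σ μ ν x

lemma hJ_integrable (σ μ ν : ℝ) (hσ : 0 < σ) (c a : ℕ) : Integrable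
    (fun x => hermiteP c ((x - μ) / σ) * hermiteP a ((x - ν) / σ) * EE σ μ ν x) := by
  obtain ⟨p, hp⟩ := herm_poly c
  obtain ⟨q, hq⟩ := herm_poly a
  have h := (poly_gauss_integrable (1 / σ ^ 2) ((μ + ν) / 2) (by positivity)
    ((p.comp (Polynomial.C (1 / σ) * (Polynomial.X - Polynomial.C μ))) *
    (q.comp (Polynomial.C (1 / σ) * (Polynomial.X - Polynomial.C ν))))).const_mul
      (Real.exp (-(μ - ν) ^ 2 / (4 * σ ^ 2)))
  refine h.congr (Filter.Eventually.of_forall fun x => ?_)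
  simp only [hp, hq, EE_eq σ μ ν x hσ, Polynomial.eval_mul, Polynomial.eval_comp,
    Polynomial.eval_C, Polynomial.eval_sub, Polynomial.eval_X]
  rw [show 1 / σ * (x - μ) = (x - μ) / σ by ring, show 1 / σ * (x - ν) = (x - ν) / σ by ring]
  ring

lemma hJ_rec (σ μ ν : ℝ) (hσ : 0 < σ) (c a : ℕ) :
    hJ σ μ ν (c + 1) a = 2 * a * hJ σ μ ν c (a - 1) - (μ - ν) / σ * hJ σ μ ν c a := by
  have hi := hJ_integrable σ μ ν hσ
  have hh (n : ℕ) (m x : ℝ) : HasDerivAt (fun x => hermiteP n ((x - m) / σ))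
      (2 * n * hermiteP (n - 1) ((x - m) / σ) * (1 / σ)) x :=
    (herm_deriv n ((x - m) / σ)).comp x (((hasDerivAt_id x).sub_const m).div_const σ)
  have hd : ∀ x, HasDerivAt
      (fun x => hermiteP c ((x - μ) / σ) * hermiteP a ((x - ν) / σ) * EE σ μ ν x)
      ((1 / σ) * (2 * a * (hermiteP c ((x - μ) / σ) * hermiteP (a - 1) ((x - ν) / σ) * EE σ μ ν x)
        - (μ - ν) / σ * (hermiteP c ((x - μ) / σ) * hermiteP a ((x - ν) / σ) * EE σ μ ν x)
        - (hermiteP (c + 1) ((x - μ) / σ) * hermiteP a ((x - ν) / σ) * EE σ μ ν x))) x := by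
    intro x
    refine (((hh c μ x).mul (hh a ν x)).mul (EE_deriv σ μ ν x hσ)).congr_deriv ?_
    rw [herm_rec c]
    simp only [Pi.mul_apply]
    field_simp
    ring
  have h1 := ((hi c (a - 1)).const_mul (2 * (a : ℝ)))
  have h2 := ((hi c a).const_mul ((μ - ν) / σ))
  have h3 := hi (c + 1) a
  have h0 := integral_eq_zero_of_hasDerivAt_of_integrable hd (((h1.sub h2).sub h3).const_mul (1 / σ))
    (hi c a)
  have h0' := h0
  rw [integral_const_mul, integral_sub, integral_sub h1 h2, integral_const_mul,
    integral_const_mul] at h0'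
  · have : (1 / σ) ≠ 0 := by positivity
    have := (mul_eq_zero.1 h0').resolve_left this
    unfold hJ
    linarith
  · exact h1.sub h2
  · exact h3

noncomputable def uu (σ μ ν : ℝ) (c a : ℕ) : ℝ := ip (psiH c μ σ) (psiH a ν σ)

noncomputable def nrm (σ : ℝ) (j : ℕ) : ℝ :=
  (Real.sqrt (2 ^ j * (Nat.factorial j : ℝ) * σ * Real.sqrt Real.pi))⁻¹

lemma uu_eq (σ μ ν : ℝ) (c a : ℕ) :
    uu σ μ ν c a = (-1) ^ c * (-1) ^ a * nrm σ c * nrm σ a * hJ σ μ ν c a := by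
  unfold uu ip hJ
  rw [← integral_const_mul]
  congr 1
  funext x
  unfold psiH nrm EE
  ring

lemma uu_symm (σ μ ν : ℝ) (c a : ℕ) : uu σ μ ν c a = uu σ ν μ a c := by
  unfold uu ip
  congr 1
  funext x
  ring

lemma nrm_succ (σ : ℝ) (hσ : 0 < σ) (j : ℕ) :
    Real.sqrt (2 * (j + 1)) * nrm σ (j + 1) = nrm σ j := by
  unfold nrm
  rw [show (2 : ℝ) ^ (j + 1) * ((j + 1).factorial : ℝ) * σ * Real.sqrt Real.pi =
    (2 * (j + 1)) * (2 ^ j * (j.factorial : ℝ) * σ * Real.sqrt Real.pi) by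
      rw [Nat.factorial_succ]; push_cast; ring]
  rw [Real.sqrt_mul (x := 2 * ((j : ℝ) + 1)) (by positivity)]
  have : Real.sqrt (2 * ((j : ℝ) + 1)) ≠ 0 := by positivity
  rw [mul_inv, ← mul_assoc, mul_inv_cancel₀ this, one_mul]

lemma uu_zero (σ μ ν : ℝ) (hσ : 0 < σ) :
    uu σ μ ν 0 0 = Real.exp (-(μ - ν) ^ 2 / (4 * σ ^ 2)) := by
  rw [uu_eq]
  have : hJ σ μ ν 0 0 = ∫ x, EE σ μ ν x := by simp [hJ, hermiteP]
  rw [this, EE_int _ _ _ hσ]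
  have h2 : nrm σ 0 * nrm σ 0 = (σ * Real.sqrt Real.pi)⁻¹ := by
    unfold nrm
    rw [← mul_inv, Real.mul_self_sqrt (by positivity)]
    simp
  have : σ * Real.sqrt Real.pi ≠ 0 := by positivity
  calc _ = (nrm σ 0 * nrm σ 0) * (σ * Real.sqrt Real.pi) * Real.exp (-(μ - ν) ^ 2 / (4 * σ ^ 2)) := by
        ring
    _ = _ := by rw [h2, inv_mul_cancel₀ this, one_mul]

/-- first ladder relation -/
lemma uu_rec (σ μ ν : ℝ) (hσ : 0 < σ) (c a : ℕ) :
    Real.sqrt (c + 1) * uu σ μ ν (c + 1) a =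
      Real.sqrt a * uu σ μ ν c (a - 1) + (μ - ν) / (Real.sqrt 2 * σ) * uu σ μ ν c a := by
  have h2 : Real.sqrt 2 ≠ 0 := by positivity
  have h22 : Real.sqrt 2 * Real.sqrt 2 = 2 := Real.mul_self_sqrt (by norm_num)
  apply mul_left_cancel₀ h2
  have hc := nrm_succ σ hσ c
  rw [Real.sqrt_mul (by norm_num)] at hc
  rw [uu_eq, uu_eq, uu_eq, hJ_rec σ μ ν hσ]
  have ha : (-1) ^ a * nrm σ a * (2 * (a : ℝ)) =
      - (Real.sqrt 2 * Real.sqrt a * ((-1) ^ (a - 1) * nrm σ (a - 1))) := by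
    cases a with
    | zero => simp
    | succ a =>
      rw [Nat.add_sub_cancel, ← nrm_succ σ hσ a, Real.sqrt_mul (by norm_num)]
      push_cast
      have : Real.sqrt ((a : ℝ) + 1) * Real.sqrt (a + 1) = a + 1 :=
        Real.mul_self_sqrt (by positivity)
      rw [pow_succ]
      linear_combination (-1) ^ a * nrm σ (a + 1) * (Real.sqrt (a+1) * Real.sqrt (a+1) * h22 + 2 * this)
  have hm : Real.sqrt 2 * ((μ - ν) / (Real.sqrt 2 * σ)) = (μ - ν) / σ := by field_simp
  calc _ = - ((-1) ^ c * (-1) ^ a) * (Real.sqrt 2 * Real.sqrt (c + 1) * nrm σ (c + 1)) * nrm σ a *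
        (2 * a * hJ σ μ ν c (a - 1) - (μ - ν) / σ * hJ σ μ ν c a) := by ring
    _ = - (-1) ^ c * nrm σ c * hJ σ μ ν c (a - 1) * ((-1) ^ a * nrm σ a * (2 * (a : ℝ))) +
        (-1) ^ c * (-1) ^ a * nrm σ c * nrm σ a * ((μ - ν) / σ) * hJ σ μ ν c a := by
        rw [hc]; ring
    _ = _ := by rw [ha, ← hm]; ring

lemma uu_rec2 (σ μ ν : ℝ) (hσ : 0 < σ) (c a : ℕ) :
    Real.sqrt (a + 1) * uu σ μ ν c (a + 1) =
      Real.sqrt c * uu σ μ ν (c - 1) a - (μ - ν) / (Real.sqrt 2 * σ) * uu σ μ ν c a := by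
  rw [uu_symm, uu_rec _ _ _ hσ, uu_symm, uu_symm σ ν μ a c]
  ring

lemma uu_orth (σ μ : ℝ) (hσ : 0 < σ) (c : ℕ) : ∀ a : ℕ,
    uu σ μ μ c a = if c = a then 1 else 0 := by
  induction c with
  | zero =>
    intro a
    cases a with
    | zero => rw [uu_zero _ _ _ hσ]; simp
    | succ a =>
      have h := uu_rec2 σ μ μ hσ 0 a
      have : Real.sqrt ((a : ℝ) + 1) ≠ 0 := by positivity
      simp at h
      rcases h with h | h
      · exact absurd h this
      · rw [h]; simp
  | succ c ih =>
    intro a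
    have h := uu_rec σ μ μ hσ c a
    have hc : Real.sqrt ((c : ℝ) + 1) ≠ 0 := by positivity
    apply mul_left_cancel₀ hc
    rw [h, ih]
    cases a with
    | zero => simp
    | succ a =>
      simp only [Nat.add_sub_cancel, sub_self, zero_div, zero_mul, add_zero, Nat.add_right_cancel_iff]
      split_ifs with h
      · subst h; simp
      · simp

lemma hs_congr {f g : ℕ → ℝ} {s : ℝ} (h : ∀ b, f b = g b) (hg : HasSum g s) : HasSum f s := by
  rw [show f = g from funext h]; exact hg

/-- ladder relations -/
structure Lad (α : ℝ) (u : ℕ → ℕ → ℝ) : Prop where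
  z : u 0 0 = Real.exp (-α ^ 2 / 2)
  r1 : ∀ c a : ℕ, Real.sqrt (c + 1) * u (c + 1) a = Real.sqrt a * u c (a - 1) + α * u c a
  r2 : ∀ c a : ℕ, Real.sqrt (a + 1) * u c (a + 1) = Real.sqrt c * u (c - 1) a - α * u c a

lemma Lad.u0 {α : ℝ} {u : ℕ → ℕ → ℝ} (h : Lad α u) (a : ℕ) :
    u 0 a = Real.exp (-α ^ 2 / 2) * ((-α) ^ a / Real.sqrt (a.factorial)) := by
  induction a with
  | zero => simp [h.z]
  | succ a ih =>
    have h2 := h.r2 0 a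
    have hs : Real.sqrt ((a : ℝ) + 1) ≠ 0 := by positivity
    have hs' : Real.sqrt (a.factorial : ℝ) ≠ 0 := by positivity
    apply mul_left_cancel₀ hs
    rw [h2, ih, Nat.factorial_succ]
    push_cast
    rw [Real.sqrt_mul (by positivity)]
    simp only [Real.sqrt_zero, zero_mul, zero_sub]
    field_simp
    ring

lemma Lad.u0sq {α : ℝ} {u : ℕ → ℕ → ℝ} (h : Lad α u) (a : ℕ) :
    u 0 a ^ 2 = Real.exp (-α ^ 2) * ((α ^ 2) ^ a / a.factorial) := by
  rw [h.u0, mul_pow, div_pow, Real.sq_sqrt (by positivity), ← Real.exp_nat_mul, ← pow_mul,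
    mul_comm a 2, pow_mul, neg_sq]
  congr 2
  push_cast; ring

lemma Lad.hasSum0 {α : ℝ} {u : ℕ → ℕ → ℝ} (h : Lad α u) (t : ℝ) :
    HasSum (fun a => t ^ a * u 0 a ^ 2) (Real.exp ((t - 1) * α ^ 2)) := by
  have h1 := (NormedSpace.expSeries_div_hasSum_exp (𝔸 := ℝ) (t * α ^ 2)).mul_left (Real.exp (-α ^ 2))
  rw [← Real.exp_eq_exp_ℝ, ← Real.exp_add] at h1
  rw [show (t - 1) * α ^ 2 = -α ^ 2 + t * α ^ 2 by ring]
  refine hs_congr (fun a => ?_) h1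
  rw [h.u0sq, mul_pow]
  ring

lemma Lad.summ {α : ℝ} {u : ℕ → ℕ → ℝ} (h : Lad α u) (c : ℕ) :
    ∀ t : ℝ, 0 < t → Summable (fun a => t ^ a * u c a ^ 2) := by
  induction c with
  | zero => intro t _; exact (h.hasSum0 t).summable
  | succ c ih =>
    intro t ht
    have h1 := ih t ht
    have h2 := ih (2 * t) (by positivity)
    have h3 : Summable (fun a : ℕ => t ^ a * (a * u c (a - 1) ^ 2)) := by
      rw [← summable_nat_add_iff 1]
      refine Summable.of_nonneg_of_le (fun a => by positivity) (fun a => ?_) (h2.mul_left t)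
      rw [Nat.add_sub_cancel]
      have : ((a + 1 : ℕ) : ℝ) ≤ 2 ^ a := by exact_mod_cast Nat.lt_two_pow_self
      calc t ^ (a + 1) * (((a + 1 : ℕ) : ℝ) * u c a ^ 2) ≤ t ^ (a + 1) * (2 ^ a * u c a ^ 2) := by
            gcongr
        _ = _ := by rw [mul_pow]; ring
    refine Summable.of_nonneg_of_le (fun a => by positivity) (fun a => ?_)
      ((h3.mul_left 2).add (h1.mul_left (2 * α ^ 2)))
    have hr := h.r1 c a
    have hc : Real.sqrt ((c : ℝ) + 1) ^ 2 = c + 1 := Real.sq_sqrt (by positivity)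
    have ha : Real.sqrt (a : ℝ) ^ 2 = a := Real.sq_sqrt (by positivity)
    have hx : u (c + 1) a ^ 2 ≤ 2 * (a * u c (a - 1) ^ 2) + 2 * α ^ 2 * u c a ^ 2 := by
      have e1 : ((c : ℝ) + 1) * u (c + 1) a ^ 2 = (Real.sqrt a * u c (a - 1) + α * u c a) ^ 2 := by
        rw [← hr, mul_pow, hc]
      have e2 : (Real.sqrt a * u c (a - 1) + α * u c a) ^ 2 ≤
          2 * (a * u c (a - 1) ^ 2) + 2 * α ^ 2 * u c a ^ 2 := by
        have e3 : (a : ℝ) * u c (a - 1) ^ 2 = (Real.sqrt a * u c (a - 1)) ^ 2 := by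
          rw [mul_pow, ha]
        rw [e3]
        nlinarith [sq_nonneg (Real.sqrt a * u c (a - 1) - α * u c a)]
      have e4 : 0 ≤ (c : ℝ) * u (c + 1) a ^ 2 := by positivity
      linarith
    calc t ^ a * u (c + 1) a ^ 2 ≤ t ^ a * (2 * (a * u c (a - 1) ^ 2) + 2 * α ^ 2 * u c a ^ 2) := by
          gcongr
      _ = _ := by ring

lemma Lad.summ2 {α : ℝ} {u : ℕ → ℕ → ℝ} (h : Lad α u) (c c' : ℕ) :
    Summable (fun a => u c a * u c' a) := by
  have h1 := h.summ c 1 one_pos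
  have h2 := h.summ c' 1 one_pos
  simp only [one_pow, one_mul] at h1 h2
  refine Summable.of_norm_bounded (h1.add h2) (fun a => ?_)
  rw [Real.norm_eq_abs, abs_le]
  constructor <;> nlinarith [sq_nonneg (u c a + u c' a), sq_nonneg (u c a - u c' a),
    sq_nonneg (u c a), sq_nonneg (u c' a)]

lemma Lad.step {α : ℝ} {u : ℕ → ℕ → ℝ} (h : Lad α u) (c c' : ℕ) :
    Real.sqrt (c + 1) * ∑' a, u (c + 1) a * u c' a =
      Real.sqrt c' * ∑' a, u c a * u (c' - 1) a := by
  have hs1 := (h.summ2 c (c' - 1)).hasSum.mul_left (Real.sqrt c')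
  have hs2 := (h.summ2 c c').hasSum.mul_left α
  have hs3 := (h.summ2 (c + 1) c').hasSum.mul_left (Real.sqrt (c + 1))
  have h3 := hs1.sub hs2
  have h4 : HasSum (fun a : ℕ => Real.sqrt a * u c (a - 1) * u c' a)
      (Real.sqrt c' * ∑' a, u c a * u (c' - 1) a - α * ∑' a, u c a * u c' a) := by
    rw [← hasSum_nat_add_iff' 1]
    simp only [Finset.range_one, Finset.sum_singleton, Nat.cast_zero, Real.sqrt_zero, zero_mul,
      sub_zero, Nat.add_sub_cancel]
    refine hs_congr (fun a => ?_) h3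
    have := h.r2 c' a
    push_cast
    linear_combination u c a * this
  have h5 := h4.add hs2
  have h6 := hs3.unique (by
    refine hs_congr (fun a => ?_) h5
    have := h.r1 c a
    linear_combination u c' a * this)
  rw [h6]; ring

lemma Lad.orth {α : ℝ} {u : ℕ → ℕ → ℝ} (h : Lad α u) (c : ℕ) : ∀ c' : ℕ,
    ∑' a, u c a * u c' a = if c = c' then 1 else 0 := by
  have key : ∀ c c' : ℕ, c' ≠ 0 ∨ c = 0 ∨ True → ∑' a, u (c + 1) a * u c' a =
      (Real.sqrt c' / Real.sqrt (c + 1)) * ∑' a, u c a * u (c' - 1) a := by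
    intro c c' _
    have hc : Real.sqrt ((c : ℝ) + 1) ≠ 0 := by positivity
    have := h.step c c'
    field_simp
    linarith
  induction c with
  | zero =>
    intro c'
    cases c' with
    | zero =>
      have := (h.hasSum0 1).tsum_eq
      simp only [one_pow, one_mul, sub_self, zero_mul, Real.exp_zero] at this
      simpa [← sq] using this
    | succ c' =>
      have e : ∑' a, u 0 a * u (c' + 1) a = ∑' a, u (c' + 1) a * u 0 a := by
        congr 1; funext a; ring
      rw [e, key c' 0 (by simp)]
      simp
  | succ c ih =>
    intro c'
    rw [key c c' (by simp), ih]
    have hc : Real.sqrt ((c : ℝ) + 1) ≠ 0 := by positivity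
    cases c' with
    | zero => simp
    | succ c' =>
      simp only [Nat.add_sub_cancel, Nat.add_right_cancel_iff]
      split_ifs with h
      · subst h; push_cast; field_simp
      · simp

lemma Lad.mulx {α : ℝ} {u : ℕ → ℕ → ℝ} (h : Lad α u) (c a : ℕ) :
    (a : ℝ) * u c a = (c + α ^ 2) * u c a - α * Real.sqrt c * u (c - 1) a
      - α * Real.sqrt (c + 1) * u (c + 1) a := by
  have hs : Real.sqrt (a : ℝ) * Real.sqrt a = a := Real.mul_self_sqrt (by positivity)
  have e1 : Real.sqrt a * u c a * Real.sqrt a =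
      (Real.sqrt c * u (c - 1) (a - 1) - α * u c (a - 1)) * Real.sqrt a := by
    cases a with
    | zero => simp
    | succ a =>
      have := h.r2 c a
      push_cast
      rw [this]
  have e2 := h.r1 c a
  have e3 : Real.sqrt c * (Real.sqrt a * u (c - 1) (a - 1)) =
      c * u c a - α * Real.sqrt c * u (c - 1) a := by
    cases c with
    | zero => simp
    | succ c =>
      have h1 := h.r1 c a
      have hs : Real.sqrt ((c : ℝ) + 1) * Real.sqrt (c + 1) = c + 1 :=
        Real.mul_self_sqrt (by positivity)
      simp only [Nat.add_sub_cancel]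
      push_cast
      linear_combination -Real.sqrt (c + 1) * h1 + u (c + 1) a * hs
  linear_combination -u c a * hs + e1 + e3 + α * e2

lemma Lad.span {α : ℝ} {u : ℕ → ℕ → ℝ} (h : Lad α u) (m : ℕ) (b : Fin m → ℝ) :
    ∃ q : ℕ → ℝ, ∀ a : ℕ, u 0 a * ∏ i, ((a : ℝ) - b i) = ∑ c ∈ Finset.range (m + 1), q c * u c a := by
  induction m with
  | zero => exact ⟨fun _ => 1, fun a => by simp⟩
  | succ m ih =>
    obtain ⟨q, hq⟩ := ih (fun i => b i.castSucc)
    have key : ∀ n c : ℕ, c < n → ∀ y : ℝ, ∃ p : ℕ → ℝ, ∀ a : ℕ, ((a : ℝ) - y) * u c a =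
        ∑ d ∈ Finset.range (n + 1), p d * u d a := by
      intro n c hc y
      refine ⟨fun d => (if d = c then c + α ^ 2 - y else 0) +
        (if d = c - 1 then - α * Real.sqrt c else 0) +
        (if d = c + 1 then - α * Real.sqrt (c + 1) else 0), fun a => ?_⟩
      simp only [add_mul, ite_mul, zero_mul, Finset.sum_add_distrib, Finset.sum_ite_eq',
        Finset.mem_range]
      rw [if_pos (by omega), if_pos (by omega), if_pos (by omega)]
      have := h.mulx c a
      linear_combination this
    have key2 : ∀ c : ℕ, ∃ p : ℕ → ℝ, c < m + 1 → ∀ a : ℕ, ((a : ℝ) - b (Fin.last m)) * u c a =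
        ∑ d ∈ Finset.range (m + 1 + 1), p d * u d a := by
      intro c
      by_cases hc : c < m + 1
      · obtain ⟨p, hp⟩ := key (m + 1) c hc (b (Fin.last m))
        exact ⟨p, fun _ => hp⟩
      · exact ⟨0, fun h => absurd h hc⟩
    choose p hp using key2
    refine ⟨fun d => ∑ c ∈ Finset.range (m + 1), q c * p c d, fun a => ?_⟩
    rw [Fin.prod_univ_castSucc, ← mul_assoc, hq, Finset.sum_mul]
    simp_rw [Finset.sum_mul]
    rw [Finset.sum_comm]
    refine Finset.sum_congr rfl fun c hc => ?_
    have := hp c (Finset.mem_range.1 hc) a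
    calc _ = q c * (((a : ℝ) - b (Fin.last m)) * u c a) := by ring
      _ = _ := by rw [this, Finset.mul_sum]; refine Finset.sum_congr rfl fun d _ => by ring

lemma Lad.coef {α : ℝ} {u : ℕ → ℕ → ℝ} (h : Lad α u) (n : ℕ) (q : ℕ → ℝ) :
    HasSum (fun a => (∑ c ∈ Finset.range n, q c * u c a) ^ 2) (∑ c ∈ Finset.range n, q c ^ 2) := by
  have h1 : ∀ c c', HasSum (fun a => (q c * q c') * (u c a * u c' a))
      ((q c * q c') * if c = c' then 1 else 0) := fun c c' => by
    have := (h.summ2 c c').hasSum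
    rw [h.orth] at this
    exact this.mul_left _
  have h2 := hasSum_sum (s := Finset.range n) fun c _ =>
    hasSum_sum (s := Finset.range n) fun c' _ => h1 c c'
  convert h2 using 1
  · funext a
    rw [sq, Finset.sum_mul_sum]
    refine Finset.sum_congr rfl fun c _ => Finset.sum_congr rfl fun d _ => by ring
  · refine Finset.sum_congr rfl fun c hc => ?_
    simp only [mul_ite, mul_one, mul_zero, Finset.sum_ite_eq]
    rw [if_pos hc, sq]

lemma choose_bd (n d : ℕ) : ((n + d).choose n : ℝ) ≤ 4 ^ n * (4 / 3) ^ (d + 1) := by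
  induction n generalizing d with
  | zero =>
    simp
    exact one_le_pow₀ (by norm_num)
  | succ n ihn =>
    induction d with
    | zero =>
      simp
      have : (1 : ℝ) ≤ 4 ^ (n + 1) := one_le_pow₀ (by norm_num)
      linarith
    | succ d ihd =>
      have h1 := ihn (d + 1)
      rw [show n + 1 + (d + 1) = (n + d + 1) + 1 by ring, Nat.choose_succ_succ]
      push_cast
      rw [show n + (d + 1) = n + d + 1 by ring] at h1
      rw [show n + 1 + d = n + d + 1 by ring] at ihd
      calc _ ≤ (4 : ℝ) ^ n * (4 / 3) ^ (d + 1 + 1) + 4 ^ (n + 1) * (4 / 3) ^ (d + 1) :=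
            add_le_add h1 ihd
        _ = _ := by ring

lemma prod_bd (d : ℕ) (S : Finset ℕ) : (∀ s ∈ S, 0 < s) →
    ∏ s ∈ S, (1 + (d : ℝ) / s) ≤ ((S.card + d).choose S.card : ℝ) := by
  induction S using Finset.induction_on_max with
  | empty => intro _; simp
  | insert a S hmax ih =>
    intro hpos
    have hS := ih (fun s hs => hpos s (Finset.mem_insert_of_mem hs))
    have ha : a ∉ S := fun h => lt_irrefl _ (hmax a h)
    rw [Finset.prod_insert ha, Finset.card_insert_of_notMem ha]
    have hcard : S.card + 1 ≤ a := by
      have : S ⊆ Finset.Ico 1 a := fun s hs =>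
        Finset.mem_Ico.2 ⟨hpos s (Finset.mem_insert_of_mem hs), hmax s hs⟩
      have h := Finset.card_le_card this
      have ha0 := hpos a (Finset.mem_insert_self a S)
      simp at h
      omega
    set n := S.card
    have e : (((n + 1 + d).choose (n + 1) : ℕ) : ℝ) = (1 + (d : ℝ) / (n + 1)) * ((n + d).choose n : ℝ) := by
      have := Nat.add_one_mul_choose_eq (n + d) n
      have h' : ((n : ℝ) + d + 1) * ((n + d).choose n : ℝ) = ((n + d + 1).choose (n + 1) : ℝ) * (n + 1) := by
        exact_mod_cast this
      rw [show n + 1 + d = n + d + 1 by ring]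
      have : (n : ℝ) + 1 ≠ 0 := by positivity
      field_simp
      linarith
    rw [e]
    have hc : (n : ℝ) + 1 ≤ a := by exact_mod_cast hcard
    have hd : (d : ℝ) / a ≤ d / (n + 1) := by gcongr
    refine mul_le_mul (by linarith) hS (Finset.prod_nonneg fun s _ => by positivity) (by positivity)

lemma prod_bd' {ι : Type*} (d : ℕ) (T : Finset ι) (s : ι → ℕ) (hinj : Set.InjOn s T)
    (hpos : ∀ i ∈ T, 0 < s i) :
    ∏ i ∈ T, (1 + (d : ℝ) / s i) ≤ 4 ^ T.card * (4 / 3) ^ (d + 1) := by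
  have h := prod_bd d (T.image s) (by
    intro x hx
    obtain ⟨i, hi, rfl⟩ := Finset.mem_image.1 hx
    exact hpos i hi)
  rw [Finset.prod_image hinj, Finset.card_image_of_injOn hinj] at h
  exact h.trans (choose_bd _ _)

lemma prod_main (m j x : ℕ) (a : Fin m → ℕ) (ha : Function.Injective a) (hj : ∀ i, a i ≠ j) :
    (∏ i, ((x : ℝ) - a i)) ^ 2 ≤ 16 ^ (m + 1) * 4 ^ j * 4 ^ x * (∏ i, ((j : ℝ) - a i)) ^ 2 := by
  obtain ⟨d, hd, hd2⟩ : ∃ d : ℕ, |(x : ℝ) - j| ≤ d ∧ d ≤ x + j := by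
    rcases le_total x j with h | h
    · refine ⟨j - x, ?_, by omega⟩
      rw [Nat.cast_sub h, abs_sub_comm, abs_of_nonneg]
      have : (x : ℝ) ≤ j := by exact_mod_cast h
      linarith
    · refine ⟨x - j, ?_, by omega⟩
      rw [Nat.cast_sub h, abs_of_nonneg]
      have : (j : ℝ) ≤ x := by exact_mod_cast h
      linarith
  have hne : ∀ i, 0 < |(j : ℝ) - a i| := fun i => by
    rw [abs_pos, sub_ne_zero]
    exact_mod_cast (hj i).symm
  have h1 : |∏ i, ((x : ℝ) - a i)| ≤ (∏ i, (1 + (d : ℝ) / |(j : ℝ) - a i|)) *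
      |∏ i, ((j : ℝ) - a i)| := by
    rw [Finset.abs_prod, Finset.abs_prod, ← Finset.prod_mul_distrib]
    refine Finset.prod_le_prod (fun i _ => abs_nonneg _) fun i _ => ?_
    rw [add_mul, one_mul, div_mul_cancel₀ _ (hne i).ne']
    calc |(x : ℝ) - a i| = |((j : ℝ) - a i) + (x - j)| := by ring_nf
      _ ≤ _ := (abs_add_le _ _).trans (by linarith)
  have h2 : ∏ i, (1 + (d : ℝ) / |(j : ℝ) - a i|) ≤ 4 ^ m * ((4 / 3) ^ (d + 1) * (4 / 3) ^ (d + 1)) := by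
    rw [← Finset.prod_filter_mul_prod_filter_not Finset.univ (fun i => a i < j)]
    have e1 := prod_bd' d (Finset.univ.filter (fun i => a i < j)) (fun i => j - a i)
      (by
        intro i hi i' hi' h
        simp at hi hi' h
        exact ha (by omega))
      (by intro i hi; simp at hi; simp; omega)
    have e2 := prod_bd' d (Finset.univ.filter (fun i => ¬ a i < j)) (fun i => a i - j)
      (by
        intro i hi i' hi' h
        simp at hi hi' h
        exact ha (by omega))
      (by intro i hi; simp at hi; have := hj i; simp; omega)
    have f1 : ∏ i with a i < j, (1 + (d : ℝ) / |(j : ℝ) - a i|) =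
        ∏ i with a i < j, (1 + (d : ℝ) / ((j - a i : ℕ) : ℝ)) := by
      refine Finset.prod_congr rfl fun i hi => ?_
      simp at hi
      have : (a i : ℝ) ≤ j := by exact_mod_cast hi.le
      rw [Nat.cast_sub hi.le, abs_of_nonneg (by linarith)]
    have f2 : ∏ i with ¬ a i < j, (1 + (d : ℝ) / |(j : ℝ) - a i|) =
        ∏ i with ¬ a i < j, (1 + (d : ℝ) / ((a i - j : ℕ) : ℝ)) := by
      refine Finset.prod_congr rfl fun i hi => ?_
      simp at hi
      have : (j : ℝ) ≤ a i := by exact_mod_cast hi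
      rw [Nat.cast_sub hi, abs_sub_comm, abs_of_nonneg (by linarith)]
    rw [f1, f2]
    have hcard := Finset.card_filter_add_card_filter_not (s := (Finset.univ : Finset (Fin m)))
      (fun i => a i < j)
    rw [Finset.card_univ, Fintype.card_fin] at hcard
    calc _ ≤ _ := mul_le_mul e1 e2 (Finset.prod_nonneg fun s _ => by positivity) (by positivity)
      _ = _ := by
        rw [show (4 : ℝ) ^ m = 4 ^ (_ + _) from congrArg _ hcard.symm, pow_add]; ring
  have h3 : (4 : ℝ) ^ m * ((4 / 3) ^ (d + 1) * (4 / 3) ^ (d + 1)) ≤ 4 ^ (m + 1) * 2 ^ j * 2 ^ x := by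
    calc (4 : ℝ) ^ m * ((4 / 3) ^ (d + 1) * (4 / 3) ^ (d + 1)) = 4 ^ m * (16 / 9) ^ (d + 1) := by
          rw [← mul_pow]; norm_num
      _ ≤ 4 ^ m * 2 ^ (d + 1) := by gcongr; norm_num
      _ ≤ 4 ^ m * 2 ^ (x + j + 1) := by gcongr; norm_num
      _ = 4 ^ m * 2 * 2 ^ j * 2 ^ x := by ring
      _ ≤ 4 ^ m * 4 * 2 ^ j * 2 ^ x := by gcongr; norm_num
      _ = _ := by ring
  have h4 : |∏ i, ((x : ℝ) - a i)| ≤ 4 ^ (m + 1) * 2 ^ j * 2 ^ x * |∏ i, ((j : ℝ) - a i)| :=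
    h1.trans (mul_le_mul_of_nonneg_right (h2.trans h3) (abs_nonneg _))
  have h5 := pow_le_pow_left₀ (abs_nonneg _) h4 2
  rw [sq_abs, mul_pow, sq_abs] at h5
  refine h5.trans (le_of_eq ?_)
  congr 1
  rw [mul_pow, mul_pow, ← pow_mul, ← pow_mul, ← pow_mul, mul_comm (m + 1), mul_comm j, mul_comm x,
    pow_mul, pow_mul, pow_mul]
  norm_num

/-- symmetric Cauchy-Binet -/
lemma cb_sym (R : Finset ℕ) (l : ℕ) (V : ℕ → Fin l → ℝ) :
    ∑ f ∈ Fintype.piFinset (fun _ : Fin l => R), (Matrix.of fun i c => V (f i) c).det ^ 2 =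
      l.factorial * (Matrix.of fun c c' => ∑ a ∈ R, V a c * V a c').det := by
  set M : Matrix (Fin l) (Fin l) ℝ := Matrix.of fun c c' => ∑ a ∈ R, V a c * V a c' with hM
  have h1 : ∀ f : Fin l → ℕ, (Matrix.of fun i c => V (f i) c).det ^ 2 =
      ∑ s : Equiv.Perm (Fin l), ∑ t : Equiv.Perm (Fin l),
        ((Equiv.Perm.sign s : ℤ) : ℝ) * ((Equiv.Perm.sign t : ℤ) : ℝ) *
          ∏ i, (V (f i) (s i) * V (f i) (t i)) := by
    intro f
    rw [← Matrix.det_transpose, sq, Matrix.det_apply', Finset.sum_mul_sum]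
    refine Finset.sum_congr rfl fun s _ => Finset.sum_congr rfl fun t _ => ?_
    rw [Finset.prod_mul_distrib]
    simp only [Matrix.transpose_apply, Matrix.of_apply]
    ring
  simp_rw [h1]
  rw [Finset.sum_comm]
  have h2 : ∀ s : Equiv.Perm (Fin l), ∑ f ∈ Fintype.piFinset (fun _ : Fin l => R), ∑ t : Equiv.Perm (Fin l),
        ((Equiv.Perm.sign s : ℤ) : ℝ) * ((Equiv.Perm.sign t : ℤ) : ℝ) *
          ∏ i, (V (f i) (s i) * V (f i) (t i)) = M.det := by
    intro s
    rw [Finset.sum_comm]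
    have h3 : ∀ t : Equiv.Perm (Fin l), ∑ f ∈ Fintype.piFinset (fun _ : Fin l => R),
        ((Equiv.Perm.sign s : ℤ) : ℝ) * ((Equiv.Perm.sign t : ℤ) : ℝ) *
          ∏ i, (V (f i) (s i) * V (f i) (t i)) =
        ((Equiv.Perm.sign s : ℤ) : ℝ) * (((Equiv.Perm.sign t : ℤ) : ℝ) *
          ∏ i, (M.submatrix s id).transpose (t i) i) := by
      intro t
      rw [← Finset.mul_sum, mul_assoc]
      congr 2
      simp only [Matrix.transpose_apply, Matrix.submatrix_apply, id, hM, Matrix.of_apply]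
      rw [Finset.prod_univ_sum]
    simp_rw [h3]
    rw [← Finset.mul_sum, ← Matrix.det_apply', Matrix.det_transpose, Matrix.det_permute, ← mul_assoc,
      ← Int.cast_mul, ← Units.val_mul, Int.units_mul_self]
    simp
  rw [Finset.sum_congr rfl fun s _ => h2 s]
  simp [Fintype.card_perm]

lemma Lad.point {α : ℝ} {u : ℕ → ℕ → ℝ} (h : Lad α u) (hα : α ≠ 0) (m j : ℕ) (k : Fin (m + 1))
    (a : Fin m → ℕ) (ha : Function.Injective a) (hj : ∀ i, a i ≠ j) :
    (Matrix.of fun (i c : Fin m) => u (k.succAbove c) (a i)).det ^ 2 ≤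
      (Real.exp (4 * α ^ 2) * 16 ^ (m + 1) * 4 ^ j * j.factorial / (α ^ 2) ^ j) *
      (Matrix.of fun (i c : Fin (m + 1)) => u c (Fin.snoc (α := fun _ => ℕ) a j i)).det ^ 2 := by
  set W : Matrix (Fin (m + 1)) (Fin (m + 1)) ℝ :=
    Matrix.of fun (i c : Fin (m + 1)) => u c (Fin.snoc (α := fun _ => ℕ) a j i) with hW
  obtain ⟨q, hq⟩ := h.span m (fun i => (a i : ℝ))
  set P : ℝ := ∏ i, ((j : ℝ) - a i) with hP
  have hP0 : P ≠ 0 := by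
    rw [hP, Finset.prod_ne_zero_iff]
    intro i _
    rw [sub_ne_zero]
    exact_mod_cast (hj i).symm
  set D := (Matrix.of fun (i c : Fin m) => u (k.succAbove c) (a i)).det with hD
  -- Cramer
  have hcr : q k * W.det = (-1) ^ (m + (k : ℕ)) * (u 0 j * P) * D := by
    have h1 := Matrix.det_updateCol_sum W k (fun c => q c)
    rw [smul_eq_mul] at h1
    rw [← h1, Matrix.det_succ_column _ k, Fin.sum_univ_castSucc]
    have hz : ∀ i : Fin (m + 1), (W.updateCol k fun i => ∑ c : Fin (m + 1), q c • W i c) i k =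
        u 0 (Fin.snoc (α := fun _ => ℕ) a j i) *
          ∏ t, (((Fin.snoc (α := fun _ => ℕ) a j i : ℕ) : ℝ) - a t) := by
      intro i
      rw [Matrix.updateCol_self, hq, Finset.sum_range]
      rfl
    rw [Finset.sum_eq_zero, zero_add, hz]
    · rw [Fin.snoc_last]
      have hDD : ((W.updateCol k fun i => ∑ c : Fin (m + 1), q c • W i c).submatrix
          (Fin.last m).succAbove k.succAbove).det = D := by
        rw [hD]
        congr 1
        ext i c
        simp [Matrix.submatrix_apply, Matrix.updateCol_ne, hW]
      rw [hDD, Fin.val_last]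
    · intro i _
      rw [hz]
      rw [Finset.prod_eq_zero (Finset.mem_univ i)]
      · simp
      · simp
  -- coefficient bound
  have hqb : q k ^ 2 ≤ Real.exp (3 * α ^ 2) * 16 ^ (m + 1) * 4 ^ j * P ^ 2 := by
    have h1 := h.coef (m + 1) q
    have h2 : q k ^ 2 ≤ ∑ c ∈ Finset.range (m + 1), q c ^ 2 :=
      Finset.single_le_sum (f := fun c => q c ^ 2) (fun i _ => sq_nonneg _)
        (Finset.mem_range.2 k.isLt)
    have h3 := (h.hasSum0 4).mul_left (16 ^ (m + 1) * 4 ^ j * P ^ 2)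
    have h4 := hasSum_le (fun x => ?_) h1 h3
    · refine h2.trans (h4.trans (le_of_eq ?_))
      norm_num
      ring
    · rw [← hq, mul_pow]
      have := prod_main m j x a ha hj
      calc u 0 x ^ 2 * (∏ i, ((x : ℝ) - a i)) ^ 2 ≤ u 0 x ^ 2 *
            (16 ^ (m + 1) * 4 ^ j * 4 ^ x * P ^ 2) := by gcongr
        _ = _ := by ring
  have hu := h.u0sq j
  have hcr2 : q k ^ 2 * W.det ^ 2 = u 0 j ^ 2 * P ^ 2 * D ^ 2 := by
    rw [← mul_pow, hcr, mul_pow, mul_pow, mul_pow, ← pow_mul, mul_comm (m + (k : ℕ)) 2, pow_mul]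
    norm_num
  have hα2 : 0 < α ^ 2 := by positivity
  have hPp : 0 < P ^ 2 := by positivity
  have hup : 0 < u 0 j ^ 2 := by rw [hu]; positivity
  have h5 : u 0 j ^ 2 * P ^ 2 * D ^ 2 ≤
      Real.exp (3 * α ^ 2) * 16 ^ (m + 1) * 4 ^ j * P ^ 2 * W.det ^ 2 := by
    rw [← hcr2]; gcongr
  have h6 : u 0 j ^ 2 * D ^ 2 ≤ Real.exp (3 * α ^ 2) * 16 ^ (m + 1) * 4 ^ j * W.det ^ 2 := by
    refine le_of_mul_le_mul_right ?_ hPp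
    calc _ = u 0 j ^ 2 * P ^ 2 * D ^ 2 := by ring
      _ ≤ _ := h5
      _ = _ := by ring
  refine le_of_mul_le_mul_left (h6.trans (le_of_eq ?_)) hup
  rw [hu]
  have he : Real.exp (4 * α ^ 2) * Real.exp (-α ^ 2) = Real.exp (3 * α ^ 2) := by
    rw [← Real.exp_add]; congr 1; ring
  rw [← he]
  field_simp

lemma snoc_range (m : ℕ) (a : Fin m → ℕ) (j : ℕ) :
    Set.range (Fin.snoc (α := fun _ => ℕ) a j) = insert j (Set.range a) := by
  ext x
  simp only [Set.mem_range, Set.mem_insert_iff]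
  constructor
  · rintro ⟨i, rfl⟩
    refine Fin.lastCases ?_ (fun i => ?_) i
    · left; simp
    · right; exact ⟨i, by simp⟩
  · rintro (rfl | ⟨i, rfl⟩)
    · exact ⟨Fin.last m, by simp⟩
    · exact ⟨i.castSucc, by simp⟩

lemma snoc_inj (m : ℕ) (a : Fin m → ℕ) (j : ℕ) (ha : Function.Injective a) (hj : ∀ i, a i ≠ j) :
    Function.Injective (Fin.snoc (α := fun _ => ℕ) a j) := by
  intro x y
  refine Fin.lastCases ?_ (fun x => ?_) x <;> refine Fin.lastCases ?_ (fun y => ?_) y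
  · simp
  · simp only [Fin.snoc_last, Fin.snoc_castSucc]
    intro h; exact absurd h.symm (hj y)
  · simp only [Fin.snoc_last, Fin.snoc_castSucc]
    intro h; exact absurd h (hj x)
  · simp only [Fin.snoc_castSucc]
    intro h; rw [ha h]

lemma sum_le_det (u : ℕ → ℕ → ℝ) (m j N : ℕ) (hj : m + 1 ≤ j)
    (T : Finset {a : Fin m → ℕ // StrictMono a ∧ ∀ c, m + 1 ≤ a c ∧ a c ≠ j})
    (hjN : j < N) (hN : ∀ K ∈ T, ∀ i, K.val i < N) :
    ∑ K ∈ T, (Matrix.of fun (i c : Fin (m + 1)) => u c (Fin.snoc (α := fun _ => ℕ) K.val j i)).det ^ 2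
      ≤ (Matrix.of fun (c c' : Fin (m + 1)) => ∑ a ∈ Finset.Ico (m + 1) N, u c a * u c' a).det := by
  classical
  have hcb := cb_sym (Finset.Ico (m + 1) N) (m + 1) (fun a c => u c a)
  set F : (Fin (m + 1) → ℕ) → ℝ := fun f =>
    (Matrix.of fun (i c : Fin (m + 1)) => u c (f i)).det ^ 2 with hF
  set G : {a : Fin m → ℕ // StrictMono a ∧ ∀ c, m + 1 ≤ a c ∧ a c ≠ j} × Equiv.Perm (Fin (m + 1)) →
    (Fin (m + 1) → ℕ) := fun p i => Fin.snoc (α := fun _ => ℕ) p.1.val j (p.2 i) with hG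
  have hGinj : Function.Injective G := by
    rintro ⟨K, s⟩ ⟨L, t⟩ hh
    have hr : Set.range (Fin.snoc (α := fun _ => ℕ) K.val j) =
        Set.range (Fin.snoc (α := fun _ => ℕ) L.val j) := by
      have := congrArg Set.range hh
      have e (K : {a : Fin m → ℕ // StrictMono a ∧ ∀ c, m + 1 ≤ a c ∧ a c ≠ j})
          (s : Equiv.Perm (Fin (m + 1))) : Set.range (G (K, s)) =
          Set.range (Fin.snoc (α := fun _ => ℕ) K.val j) :=
        s.surjective.range_comp (Fin.snoc (α := fun _ => ℕ) K.val j)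
      rwa [e, e] at this
    rw [snoc_range, snoc_range] at hr
    have hKL : Set.range K.val = Set.range L.val := by
      have hn (K : {a : Fin m → ℕ // StrictMono a ∧ ∀ c, m + 1 ≤ a c ∧ a c ≠ j}) :
          j ∉ Set.range K.val := by
        rintro ⟨i, hi⟩; exact (K.prop.2 i).2 hi
      have := congrArg (fun S => S \ {j}) hr
      simpa [Set.insert_sdiff_self_of_notMem (hn K), Set.insert_sdiff_self_of_notMem (hn L)] using this
    have hKL' : K = L := Subtype.ext ((StrictMono.range_inj K.prop.1 L.prop.1).1 hKL)
    subst hKL'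
    have hst : s = t := by
      ext i
      have := congrFun hh i
      rw [snoc_inj m K.val j K.prop.1.injective (fun i => (K.prop.2 i).2) this]
    rw [hst]
  have hFG : ∀ p, F (G p) = F (Fin.snoc (α := fun _ => ℕ) p.1.val j) := by
    rintro ⟨K, s⟩
    have := Matrix.det_permute s
      (Matrix.of fun (i c : Fin (m + 1)) => u c (Fin.snoc (α := fun _ => ℕ) K.val j i))
    have e : (Matrix.of fun (i c : Fin (m + 1)) => u c (G (K, s) i)) =
      (Matrix.of fun (i c : Fin (m + 1)) => u c (Fin.snoc (α := fun _ => ℕ) K.val j i)).submatrix s id := by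
      ext i c; rfl
    simp only [hF]
    rw [e, this, mul_pow]
    rcases Int.units_eq_one_or (Equiv.Perm.sign s) with h | h <;> rw [h] <;> simp
  have h1 : ∑ p ∈ T ×ˢ (Finset.univ : Finset (Equiv.Perm (Fin (m + 1)))), F (G p) =
      (m + 1).factorial * ∑ K ∈ T, F (Fin.snoc (α := fun _ => ℕ) K.val j) := by
    simp_rw [hFG]
    rw [Finset.sum_product]
    simp [Fintype.card_perm, Finset.mul_sum]
  have h2 : ∑ p ∈ T ×ˢ (Finset.univ : Finset (Equiv.Perm (Fin (m + 1)))), F (G p) ≤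
      ∑ f ∈ Fintype.piFinset (fun _ : Fin (m + 1) => Finset.Ico (m + 1) N), F f := by
    rw [← Finset.sum_image (f := F) (g := G) (fun x _ y _ hxy => hGinj hxy)]
    refine Finset.sum_le_sum_of_subset_of_nonneg ?_ (fun f _ _ => sq_nonneg _)
    intro f hf
    obtain ⟨⟨K, s⟩, hp, rfl⟩ := Finset.mem_image.1 hf
    have hK := (Finset.mem_product.1 hp).1
    rw [Fintype.mem_piFinset]
    intro i
    rw [Finset.mem_Ico]
    simp only [hG]
    refine Fin.lastCases ?_ (fun y => ?_) (s i)
    · simp only [Fin.snoc_last]; exact ⟨hj, hjN⟩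
    · simp only [Fin.snoc_castSucc]; exact ⟨(K.prop.2 y).1, hN K hK y⟩
  rw [h1] at h2
  simp only [hF] at h2
  rw [hcb] at h2
  exact le_of_mul_le_mul_left h2 (by positivity)

lemma Lad.sum_le {α : ℝ} {u : ℕ → ℕ → ℝ} (h : Lad α u) (m j : ℕ) (hj : m + 1 ≤ j)
    (T : Finset {a : Fin m → ℕ // StrictMono a ∧ ∀ c, m + 1 ≤ a c ∧ a c ≠ j}) :
    ∑ K ∈ T, (Matrix.of fun (i c : Fin (m + 1)) => u c (Fin.snoc (α := fun _ => ℕ) K.val j i)).det ^ 2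
      ≤ (Matrix.of fun (c c' : Fin (m + 1)) =>
        (if c = c' then 1 else 0) - ∑ a ∈ Finset.range (m + 1), u c a * u c' a).det := by
  have ht : Filter.Tendsto (fun N : ℕ => Matrix.of fun (c c' : Fin (m + 1)) =>
      ∑ a ∈ Finset.Ico (m + 1) N, u c a * u c' a) Filter.atTop
      (nhds (Matrix.of fun (c c' : Fin (m + 1)) =>
        (if c = c' then 1 else 0) - ∑ a ∈ Finset.range (m + 1), u c a * u c' a)) := by
    refine tendsto_pi_nhds.2 fun c => tendsto_pi_nhds.2 fun c' => ?_
    have h1 := (h.summ2 c c').hasSum.tendsto_sum_nat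
    rw [h.orth] at h1
    have h2 := h1.sub_const (∑ a ∈ Finset.range (m + 1), u c a * u c' a)
    simp only [Matrix.of_apply, Fin.ext_iff]
    refine h2.congr' ?_
    filter_upwards [Filter.eventually_ge_atTop (m + 1)] with N hN
    rw [Finset.sum_Ico_eq_sub _ hN]
  have hd := ((Continuous.matrix_det continuous_id).tendsto _).comp ht
  refine ge_of_tendsto hd ?_
  filter_upwards [Filter.eventually_gt_atTop j,
    Filter.eventually_gt_atTop (T.sup fun K => Finset.univ.sup K.val)] with N h1 h2
  refine sum_le_det u m j N hj T h1 fun K hK i => lt_of_le_of_lt ?_ h2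
  exact (Finset.le_sup (f := K.val) (Finset.mem_univ i)).trans
    (Finset.le_sup (f := fun K : {a : Fin m → ℕ // StrictMono a ∧ ∀ c, m + 1 ≤ a c ∧ a c ≠ j} =>
      Finset.univ.sup K.val) hK)

lemma matA_det (l : ℕ) (r σ : ℝ) (hσ : 0 < σ) : (matA l r σ).det =
    (Matrix.of fun (c c' : Fin l) =>
        (if c = c' then 1 else 0) - ∑ a ∈ Finset.range l, uu σ r 0 c a * uu σ r 0 c' a).det := by
  let e : Fin l ⊕ Fin l ≃ Fin 2 × Fin l :=
    { toFun := Sum.elim (fun i => (0, i)) (fun i => (1, i))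
      invFun := fun p => if p.1 = 0 then Sum.inl p.2 else Sum.inr p.2
      left_inv := by rintro (i | i) <;> simp
      right_inv := by
        rintro ⟨p, i⟩
        fin_cases p <;> simp }
  rw [← Matrix.det_submatrix_equiv_self e]
  have : (matA l r σ).submatrix e e = Matrix.fromBlocks 1
      (Matrix.of fun (a c : Fin l) => uu σ r 0 c a)
      (Matrix.of fun (c a : Fin l) => uu σ r 0 c a) 1 := by
    ext p q
    rcases p with p | p <;> rcases q with q | q
    · have := uu_orth σ 0 hσ p q
      simp only [← Fin.ext_iff] at this
      simpa [e, matA, uu, Matrix.one_apply] using this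
    · have := uu_symm σ 0 r p q
      simpa [e, matA, uu] using this
    · simp [e, matA, uu]
    · have := uu_orth σ r hσ p q
      simp only [← Fin.ext_iff] at this
      simpa [e, matA, uu, Matrix.one_apply] using this
  rw [this, Matrix.det_fromBlocks_one₁₁]
  congr 1
  ext c c'
  simp [Matrix.mul_apply, Matrix.one_apply, Finset.sum_range]

lemma uu_lad (σ r : ℝ) (hσ : 0 < σ) : Lad (r / (Real.sqrt 2 * σ)) (uu σ r 0) where
  z := by
    rw [uu_zero _ _ _ hσ]
    congr 1
    rw [div_pow, mul_pow, Real.sq_sqrt (by norm_num)]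
    field_simp
    ring
  r1 := fun c a => by simpa using uu_rec σ r 0 hσ c a
  r2 := fun c a => by simpa using uu_rec2 σ r 0 hσ c a

/-- Lemma 33. For `ℓ = m + 1 ≥ 1`, `k ∈ [ℓ]`, `j ≥ ℓ`, the sum over
`K ∈ 𝒦_j` (size `ℓ−1` subsets of `{ℓ, ℓ+1, …}` avoiding `j`) of `det(U_K^{(−k)})²`
is controlled by `det(A)`. -/
theorem stmt11 (σ r : ℝ) (hσ : 0 < σ) (hr : 0 < r) (m : ℕ) (k : Fin (m + 1)) (j : ℕ)
    (hj : m + 1 ≤ j) :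
    (∑' K : {a : Fin m → ℕ // StrictMono a ∧ ∀ c, m + 1 ≤ a c ∧ a c ≠ j},
        ((UKminus m σ r k K.val).det) ^ 2) ≤
      (Real.exp (5 * r ^ 2 / (4 * σ ^ 2)) * 4 ^ (m + 1) * (2 * Real.sqrt 2 * σ / r) ^ j *
          Real.sqrt (Nat.factorial j)) ^ 2 * (matA (m + 1) r σ).det := by
  have hL := uu_lad σ r hσ
  set α := r / (Real.sqrt 2 * σ) with hα
  have hα0 : 0 < α := by positivity
  have hα2 : α ^ 2 = r ^ 2 / (2 * σ ^ 2) := by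
    rw [hα, div_pow, mul_pow, Real.sq_sqrt (by norm_num)]
  set C : ℝ := Real.exp (4 * α ^ 2) * 16 ^ (m + 1) * 4 ^ j * j.factorial / (α ^ 2) ^ j with hC
  set B : ℝ := (Real.exp (5 * r ^ 2 / (4 * σ ^ 2)) * 4 ^ (m + 1) *
    (2 * Real.sqrt 2 * σ / r) ^ j * Real.sqrt (Nat.factorial j)) ^ 2 with hB
  have hB' : B = Real.exp (5 * α ^ 2) * 16 ^ (m + 1) * 4 ^ j * j.factorial / (α ^ 2) ^ j := by
    have e1 : Real.exp (5 * r ^ 2 / (4 * σ ^ 2)) ^ 2 = Real.exp (5 * α ^ 2) := by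
      rw [← Real.exp_nat_mul, hα2]
      congr 1
      push_cast
      field_simp
      ring
    have e2 : ((4 : ℝ) ^ (m + 1)) ^ 2 = 16 ^ (m + 1) := by
      rw [← pow_mul, mul_comm, pow_mul]; norm_num
    have e3 : ((2 * Real.sqrt 2 * σ / r) ^ j) ^ 2 = 4 ^ j / (α ^ 2) ^ j := by
      have e4 : (2 * Real.sqrt 2 * σ / r) ^ 2 = 4 / α ^ 2 := by
        rw [hα2, div_pow, mul_pow, mul_pow, Real.sq_sqrt (by norm_num)]
        field_simp
        ring
      rw [← pow_mul, mul_comm j 2, pow_mul, ← div_pow, e4]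
    rw [hB, mul_pow, mul_pow, mul_pow, e1, e2, e3, Real.sq_sqrt (by positivity)]
    ring
  have hCB : C ≤ B := by
    rw [hB', hC]
    gcongr
    norm_num
  have hC0 : 0 ≤ C := by positivity
  refine Real.tsum_le_of_sum_le (fun K => sq_nonneg _) fun T => ?_
  have hs := hL.sum_le m j hj T
  rw [← matA_det (m + 1) r σ hσ] at hs
  have h0 := (Finset.sum_nonneg fun K (_ : K ∈ T) => sq_nonneg _).trans hs
  calc _ ≤ ∑ K ∈ T, C * (Matrix.of fun (i c : Fin (m + 1)) =>
        uu σ r 0 c (Fin.snoc (α := fun _ => ℕ) K.val j i)).det ^ 2 :=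
        Finset.sum_le_sum fun K _ => hL.point hα0.ne' m j k K.val K.prop.1.injective
          fun i => (K.prop.2 i).2
    _ = C * _ := by rw [← Finset.mul_sum]
    _ ≤ C * (matA (m + 1) r σ).det := mul_le_mul_of_nonneg_left hs hC0
    _ ≤ _ := mul_le_mul_of_nonneg_right hCB h0
end

section
/- Let ℓ ≥ 1 and let a_0 < a_1 < ⋯ < a_{ℓ−1} be nonnegative integers with a_c ≠ j for every c, for some j ∈ ℕ₀. Then Π_{c=0}^{ℓ−1} |a_c/(a_c − j)| ≤ 2^j · 4^ℓ. -/
theorem aux_card (T : Finset ℕ) (m : ℕ) (h1 : ∀ d ∈ T, 1 ≤ d) (hm : 1 ≤ m) (h : ∀ d ∈ T, d < m) :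
    T.card + 1 ≤ m := by
  have : T ⊆ Finset.Icc 1 (m-1) := by
    intro d hd
    have := h1 d hd
    have := h d hd
    simp only [Finset.mem_Icc]; omega
  have := Finset.card_le_card this
  simp at this
  omega

theorem aux_up (j : ℕ) (T : Finset ℕ) : (∀ d ∈ T, 1 ≤ d) →
    ∏ d ∈ T, (((j:ℝ) + d) / d) ≤ (Nat.choose (j + T.card) T.card : ℝ) := by
  induction T using Finset.induction_on_max with
  | empty => intro _; simp
  | insert m T hlt ih =>
    intro h
    have h1 : ∀ d ∈ T, 1 ≤ d := fun d hd => h d (Finset.mem_insert_of_mem hd)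
    have hm : 1 ≤ m := h m (Finset.mem_insert_self _ _)
    have hn : m ∉ T := fun hh => lt_irrefl _ (hlt m hh)
    have hc := aux_card T m h1 hm hlt
    rw [Finset.prod_insert hn, Finset.card_insert_of_notMem hn]
    have ih := ih h1
    set k := T.card
    have hcR : (k:ℝ) + 1 ≤ m := by exact_mod_cast hc
    have hk : (0:ℝ) ≤ k := Nat.cast_nonneg k
    have hjj : (0:ℝ) ≤ j := Nat.cast_nonneg j
    have e : (Nat.choose (j + (k+1)) (k+1) : ℝ) = ((j:ℝ) + (k+1)) / (k+1) * Nat.choose (j+k) k := by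
      have := Nat.add_one_mul_choose_eq (j+k) k
      have : ((j:ℝ)+k+1) * Nat.choose (j+k) k = Nat.choose (j+k+1) (k+1) * (k+1) := by exact_mod_cast this
      rw [← add_assoc j k 1]
      field_simp
      linarith
    rw [e]
    apply mul_le_mul _ ih (Finset.prod_nonneg fun d _ => by positivity) (by positivity)
    rw [div_le_div_iff₀ (by linarith) (by linarith)]
    nlinarith

theorem aux_down (j : ℕ) (T : Finset ℕ) : (∀ d ∈ T, 1 ≤ d) → (∀ d ∈ T, d ≤ j) →
    ∏ d ∈ T, (((j:ℝ) - d) / d) ≤ (Nat.choose j T.card : ℝ) := by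
  induction T using Finset.induction_on_max with
  | empty => intro _ _; simp
  | insert m T hlt ih =>
    intro h h'
    have h1 : ∀ d ∈ T, 1 ≤ d := fun d hd => h d (Finset.mem_insert_of_mem hd)
    have h2 : ∀ d ∈ T, d ≤ j := fun d hd => h' d (Finset.mem_insert_of_mem hd)
    have hm : 1 ≤ m := h m (Finset.mem_insert_self _ _)
    have hmj : m ≤ j := h' m (Finset.mem_insert_self _ _)
    have hn : m ∉ T := fun hh => lt_irrefl _ (hlt m hh)
    have hc := aux_card T m h1 hm hlt
    rw [Finset.prod_insert hn, Finset.card_insert_of_notMem hn]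
    have ih := ih h1 h2
    set k := T.card
    have hcR : (k:ℝ) + 1 ≤ m := by exact_mod_cast hc
    have hmR : (m:ℝ) ≤ j := by exact_mod_cast hmj
    have hk : (0:ℝ) ≤ k := Nat.cast_nonneg k
    have e : (Nat.choose j (k+1) : ℝ) = ((j:ℝ) - k) / (k+1) * Nat.choose j k := by
      have := Nat.choose_succ_right_eq j k
      have : (Nat.choose j (k+1) : ℝ) * (k+1) = Nat.choose j k * ((j:ℝ) - k) := by
        rw [← Nat.cast_sub (by omega)]; exact_mod_cast this
      field_simp
      linarith
    rw [e]
    apply mul_le_mul _ ih (Finset.prod_nonneg fun d hd => ?_) (div_nonneg (by linarith) (by linarith))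
    · rw [div_le_div_iff₀ (by linarith) (by linarith)]
      nlinarith
    · have : (d:ℝ) ≤ j := by exact_mod_cast h2 d hd
      exact div_nonneg (by linarith) (by positivity)

theorem aux_bin (n k : ℕ) (hk : k ≤ n) (x : ℝ) (hx : 0 ≤ x) :
    x ^ k * (Nat.choose n k : ℝ) ≤ (x + 1) ^ n := by
  rw [add_pow]
  have := Finset.single_le_sum (f := fun m => x ^ m * 1 ^ (n - m) * (n.choose m : ℝ))
    (s := Finset.range (n+1)) (fun i _ => by positivity) (Finset.mem_range.2 (Nat.lt_succ_of_le hk))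
  simpa using this

theorem aux_up2 (j u : ℕ) : (Nat.choose (j+u) u : ℝ) ≤ (4/3)^j * 4^u := by
  have h := aux_bin (j+u) u (by omega) (1/3) (by norm_num)
  have e : ((1:ℝ)/3 + 1)^(j+u) = (1/3)^u * ((4/3)^j * 4^u) := by
    rw [pow_add, mul_left_comm, ← mul_pow]; norm_num
  rw [e] at h
  exact le_of_mul_le_mul_left h (by positivity)

theorem aux_down2 (j s : ℕ) : (Nat.choose j s : ℝ) ≤ (5/4)^j * 4^s := by
  rcases le_or_gt s j with hs | hs
  · have h := aux_bin j s hs (1/4) (by norm_num)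
    have e : ((1:ℝ)/4 + 1)^j = (1/4)^s * ((5/4)^j * 4^s) := by
      rw [mul_left_comm, ← mul_pow]; norm_num
    rw [e] at h
    exact le_of_mul_le_mul_left h (by positivity)
  · rw [Nat.choose_eq_zero_of_lt hs]; simp only [Nat.cast_zero]; positivity

theorem aux_main (S : Finset ℕ) (j : ℕ) (hj : ∀ x ∈ S, x ≠ j) :
    (∏ x ∈ S, |(x : ℝ) / ((x : ℝ) - (j : ℝ))|) ≤ 2 ^ j * 4 ^ S.card := by
  rw [← Finset.prod_filter_mul_prod_filter_not S (fun x => x < j)]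
  rw [← Finset.card_filter_add_card_filter_not (s := S) (fun x => x < j)]
  set A := S.filter (fun x => x < j) with hA
  set B := S.filter (fun x => ¬ x < j) with hB
  have hAlt : ∀ x ∈ A, x < j := fun x hx => (Finset.mem_filter.1 hx).2
  have hBlt : ∀ x ∈ B, j < x := fun x hx => by
    have h1 := (Finset.mem_filter.1 hx).2
    have h2 := hj x (Finset.mem_filter.1 hx).1
    omega
  have iA : Set.InjOn (fun x => j - x) (A : Set ℕ) := by
    intro x hx y hy h
    have := hAlt x hx
    have := hAlt y hy
    simp only at h
    omega
  have iB : Set.InjOn (fun x => x - j) (B : Set ℕ) := by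
    intro x hx y hy h
    have := hBlt x hx
    have := hBlt y hy
    simp only at h
    omega
  have a1 : ∏ x ∈ A, |(x : ℝ) / ((x : ℝ) - (j : ℝ))| ≤ (5/4)^j * 4^A.card := by
    have := aux_down j (A.image (fun x => j - x))
      (by simp only [Finset.forall_mem_image]; intro x hx; have := hAlt x hx; omega)
      (by simp only [Finset.forall_mem_image]; intro x hx; omega)
    rw [Finset.prod_image iA, Finset.card_image_of_injOn iA] at this
    refine le_trans (le_of_eq (Finset.prod_congr rfl fun x hx => ?_)) (this.trans (aux_down2 _ _))
    have h := hAlt x hx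
    have hR : (x:ℝ) < j := by exact_mod_cast h
    rw [Nat.cast_sub h.le, abs_div, abs_of_nonneg (Nat.cast_nonneg x), abs_of_neg (by linarith)]
    congr 1 <;> ring
  have b1 : ∏ x ∈ B, |(x : ℝ) / ((x : ℝ) - (j : ℝ))| ≤ (4/3)^j * 4^B.card := by
    have := aux_up j (B.image (fun x => x - j))
      (by simp only [Finset.forall_mem_image]; intro x hx; have := hBlt x hx; omega)
    rw [Finset.prod_image iB, Finset.card_image_of_injOn iB] at this
    refine le_trans (le_of_eq (Finset.prod_congr rfl fun x hx => ?_)) (this.trans (aux_up2 _ _))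
    have h := hBlt x hx
    have hR : (j:ℝ) < x := by exact_mod_cast h
    rw [Nat.cast_sub h.le, abs_div, abs_of_nonneg (Nat.cast_nonneg x), abs_of_pos (by linarith)]
    congr 1; ring
  calc _ ≤ ((5/4:ℝ)^j * 4^A.card) * ((4/3)^j * 4^B.card) :=
        mul_le_mul a1 b1 (Finset.prod_nonneg fun _ _ => abs_nonneg _) (by positivity)
    _ = (5/3:ℝ)^j * 4^(A.card + B.card) := by
        rw [mul_mul_mul_comm, ← mul_pow, ← pow_add]; norm_num
    _ ≤ _ := by gcongr; norm_num

/-- Lemma 36. For strictly increasing nonnegative integers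
`a_0 < ⋯ < a_{ℓ−1}` none of which equals `j`, the product `Π_c |a_c/(a_c − j)|`
is at most `2^j · 4^ℓ`. -/
theorem stmt14 (ℓ : ℕ) (hℓ : 1 ≤ ℓ) (a : Fin ℓ → ℕ) (ha : StrictMono a) (j : ℕ)
    (hj : ∀ c, a c ≠ j) :
    (∏ c, |(a c : ℝ) / ((a c : ℝ) - (j : ℝ))|) ≤ 2 ^ j * 4 ^ ℓ := by
  have := aux_main (Finset.univ.image a) j (by simpa using hj)
  rw [Finset.prod_image ha.injective.injOn, Finset.card_image_of_injective _ ha.injective] at this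
  simpa using this
end

section
/- Let r ∈ ℝ, σ > 0, ℓ ≥ 1, let a_0 < ⋯ < a_{ℓ−1} be nonnegative integers, K = {a_0, …, a_{ℓ−1}}, and let b ∈ [ℓ+1] = {0,…,ℓ}. Then det((W_{r,σ})_{K, [ℓ+1]\{b}}) = e^{−ℓ r²/(8σ²)} (−1)^{Σ_K} √(b!/(F_{[ℓ+1]} F_K)) (r/(√2 σ))^{Σ_K − ℓ(ℓ+1)/2 + b} C_K · Γ_{K,b}; in particular det((W_{r,σ})_{K,[ℓ]}) = e^{−ℓ r²/(8σ²)} (−1)^{Σ_K} √(1/(F_{[ℓ]} F_K)) (r/(√2 σ))^{Σ_K − ℓ(ℓ−1)/2} C_K · Γ_{K,ℓ}. -/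
/-- The doubly-indexed array `W_{r,σ}`:
`(W_{r,σ})_{s,t} = e^{−r²/(8σ²)} (−1)^s √(t!/s!) C(s,t) (r/(√2 σ))^{s−t}`
(the binomial coefficient vanishes for `s < t`). -/
noncomputable def Wrs (r σ : ℝ) (s t : ℕ) : ℝ :=
  Real.exp (-r ^ 2 / (8 * σ ^ 2)) * (-1 : ℝ) ^ s *
    Real.sqrt ((Nat.factorial t : ℝ) / (Nat.factorial s : ℝ)) * (Nat.choose s t : ℝ) *
    (r / (Real.sqrt 2 * σ)) ^ (s - t)

/-- `Σ_K = Σ_c a_c`. -/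
def SigK {m : ℕ} (a : Fin m → ℕ) : ℕ := ∑ c, a c

/-- `F_K = Π_c a_c!`. -/
def FK {m : ℕ} (a : Fin m → ℕ) : ℕ := ∏ c, Nat.factorial (a c)

/-- `F_{[ℓ]} = Π_{c<ℓ} c!`. -/
def Fbra (ℓ : ℕ) : ℕ := ∏ c ∈ Finset.range ℓ, Nat.factorial c

/-- `C_K = Π_{c₂<c₁} (a_{c₁} − a_{c₂})`. -/
def CK {m : ℕ} (a : Fin m → ℕ) : ℝ :=
  ∏ p ∈ Finset.univ.filter (fun p : Fin m × Fin m => p.2 < p.1),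
    ((a p.1 : ℝ) - (a p.2 : ℝ))

/-- `Γ_{K,b} = (1/b!) Σ_{d=0}^b (−1)^d C(b,d) Π_c (a_c − d)`. -/
noncomputable def GamR (m : ℕ) (a : Fin m → ℝ) (b : ℕ) : ℝ :=
  (1 / (Nat.factorial b : ℝ)) *
    ∑ d ∈ Finset.range (b + 1),
      (-1 : ℝ) ^ d * (Nat.choose b d : ℝ) * ∏ c, (a c - (d : ℝ))

lemma aux_orth (b j : ℕ) : ∑ d ∈ Finset.range (b + 1),
    (-1 : ℝ) ^ d * (Nat.choose b d : ℝ) * (Nat.choose d j : ℝ) =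
      if b = j then (-1 : ℝ) ^ b else 0 := by
  have h := fwdDiff_iter_choose_zero j b
  rw [fwdDiff_iter_eq_sum_shift] at h
  have h2 := congrArg (fun z : ℤ => (-1 : ℝ) ^ b * (z : ℝ)) h
  simp only [Int.cast_sum, Finset.mul_sum] at h2
  rw [show (if b = j then (-1 : ℝ) ^ b else 0)
    = (-1 : ℝ) ^ b * (((if b = j then 1 else 0 : ℤ)) : ℝ) by split_ifs <;> simp, ← h2]
  refine Finset.sum_congr rfl fun d hd => ?_
  have hd' : d ≤ b := by simpa [Nat.lt_succ_iff] using hd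
  obtain ⟨e, rfl⟩ := Nat.exists_eq_add_of_le hd'
  have h1 : ((-1 : ℝ) ^ e) * (-1) ^ e = 1 := by rw [← mul_pow]; simp
  simp only [zero_add, smul_eq_mul, mul_one, Nat.add_sub_cancel_left, pow_add]
  push_cast
  linear_combination (-(-1 : ℝ) ^ d * (Nat.choose (d + e) d : ℝ) * (Nat.choose d j : ℝ)) * h1

noncomputable def auxD {ℓ : ℕ} (a : Fin ℓ → ℕ) (j : Fin (ℓ + 1)) : ℝ :=
  (Matrix.of fun i k : Fin ℓ => (Nat.descFactorial (a i) (j.succAbove k) : ℝ)).det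

lemma aux_CK {ℓ : ℕ} (a : Fin ℓ → ℕ) :
    CK a = ∏ i : Fin ℓ, ∏ j ∈ Finset.Ioi i, ((a j : ℝ) - (a i : ℝ)) := by
  unfold CK
  rw [Finset.prod_filter, ← Finset.univ_product_univ, Finset.prod_product_right]
  refine Finset.prod_congr rfl fun i _ => ?_
  rw [← Finset.prod_filter]
  refine Finset.prod_congr ?_ fun _ _ => rfl
  ext j; simp

lemma aux_key {ℓ : ℕ} (a : Fin ℓ → ℕ) (d : ℕ) :
    ∑ j : Fin (ℓ + 1), (-1 : ℝ) ^ (j : ℕ) * (Nat.descFactorial d j : ℝ) * auxD a j =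
      CK a * ∏ c, ((a c : ℝ) - (d : ℝ)) := by
  set v : Fin (ℓ + 1) → ℕ := Fin.cons d a with hv
  have h := Matrix.det_eval_matrixOfPolynomials_eq_det_vandermonde (fun i => (v i : ℝ))
    (fun j : Fin (ℓ + 1) => descPochhammer ℝ (j : ℕ))
    (fun j => descPochhammer_natDegree ℝ _) (fun j => monic_descPochhammer ℝ _)
  simp only [descPochhammer_eval_eq_descFactorial] at h
  rw [Matrix.det_vandermonde, Fin.prod_univ_succ, Fin.prod_Ioi_zero, Matrix.det_succ_row_zero] at h
  simp only [Fin.prod_Ioi_succ] at h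
  simp only [hv, Fin.cons_zero, Fin.cons_succ] at h
  rw [aux_CK, mul_comm (∏ i : Fin ℓ, _), h]
  rfl

lemma aux_D {ℓ : ℕ} (a : Fin ℓ → ℕ) (b : Fin (ℓ + 1)) :
    auxD a b = CK a * GamR ℓ (fun c => (a c : ℝ)) (b : ℕ) := by
  have hb : (Nat.factorial (b : ℕ) : ℝ) ≠ 0 := by positivity
  have h : ∑ d ∈ Finset.range ((b : ℕ) + 1), (-1 : ℝ) ^ d * (Nat.choose b d : ℝ) *
      (CK a * ∏ c, ((a c : ℝ) - (d : ℝ))) = (Nat.factorial (b : ℕ) : ℝ) * auxD a b := by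
    simp only [← aux_key, Finset.mul_sum]
    rw [Finset.sum_comm]
    have h3 : ∀ j : Fin (ℓ + 1), ∑ d ∈ Finset.range ((b : ℕ) + 1),
        (-1 : ℝ) ^ d * (Nat.choose b d : ℝ) *
        ((-1 : ℝ) ^ (j : ℕ) * (Nat.descFactorial d j : ℝ) * auxD a j) =
        if b = j then (Nat.factorial (b : ℕ) : ℝ) * auxD a b else 0 := by
      intro j
      have := aux_orth b j
      calc _ = ((-1 : ℝ) ^ (j : ℕ) * (Nat.factorial j : ℝ) * auxD a j) *
            ∑ d ∈ Finset.range ((b : ℕ) + 1),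
              (-1 : ℝ) ^ d * (Nat.choose b d : ℝ) * (Nat.choose d j : ℝ) := by
            rw [Finset.mul_sum]
            refine Finset.sum_congr rfl fun d _ => ?_
            rw [Nat.descFactorial_eq_factorial_mul_choose]
            push_cast; ring
        _ = _ := by
            rw [this]
            by_cases hbj : b = j
            · subst hbj
              have h1 : ((-1 : ℝ) ^ (b : ℕ)) * (-1) ^ (b : ℕ) = 1 := by rw [← mul_pow]; simp
              simp only [if_true]
              linear_combination ((Nat.factorial (b : ℕ) : ℝ) * auxD a b) * h1
            · have : (b : ℕ) ≠ j := fun h => hbj (Fin.ext h)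
              simp [hbj, this]
    simp [h3]
  unfold GamR
  field_simp
  rw [mul_comm (auxD a b), ← h, Finset.mul_sum]
  exact Finset.sum_congr rfl fun d _ => by ring

lemma aux_pow {ℓ : ℕ} (a t : Fin ℓ → ℕ) (x : ℝ) :
    (Matrix.of fun i j : Fin ℓ => (Nat.choose (a i) (t j) : ℝ) * x ^ (a i - t j)).det =
      x ^ ((∑ c, (a c : ℤ)) - ∑ c, (t c : ℤ)) *
      (Matrix.of fun i j : Fin ℓ => (Nat.choose (a i) (t j) : ℝ)).det := by
  rw [Matrix.det_apply', Matrix.det_apply', Finset.mul_sum]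
  refine Finset.sum_congr rfl fun p _ => ?_
  simp only [Matrix.of_apply]
  by_cases h : ∀ i, t i ≤ a (p i)
  · rw [Finset.prod_mul_distrib, Finset.prod_pow_eq_pow_sum]
    have : ((∑ i, (a (p i) - t i) : ℕ) : ℤ) = (∑ c, (a c : ℤ)) - ∑ c, (t c : ℤ) := by
      rw [← Equiv.sum_comp p (fun c => (a c : ℤ)), ← Finset.sum_sub_distrib]
      push_cast
      exact Finset.sum_congr rfl fun i _ => by rw [Nat.cast_sub (h i)]
    rw [← this, zpow_natCast]
    ring
  · push Not at h
    obtain ⟨i, hi⟩ := h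
    have h0 : (Nat.choose (a (p i)) (t i) : ℝ) = 0 := by
      exact_mod_cast Nat.choose_eq_zero_of_lt hi
    rw [Finset.prod_eq_zero (Finset.mem_univ i) (by rw [h0, zero_mul]),
      Finset.prod_eq_zero (Finset.mem_univ i) h0]
    simp

lemma aux_choose {ℓ : ℕ} (a : Fin ℓ → ℕ) (b : Fin (ℓ + 1)) :
    (∏ j, (Nat.factorial (b.succAbove j) : ℝ)) *
    (Matrix.of fun i j : Fin ℓ => (Nat.choose (a i) (b.succAbove j) : ℝ)).det = auxD a b := by
  rw [← Matrix.det_mul_row, auxD]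
  congr 1
  ext i j
  simp [Nat.descFactorial_eq_factorial_mul_choose]

lemma aux_W {ℓ : ℕ} (r σ : ℝ) (a t : Fin ℓ → ℕ) :
    (Matrix.of fun i j : Fin ℓ => Wrs r σ (a i) (t j)).det =
      Real.exp (-((ℓ : ℝ) * r ^ 2) / (8 * σ ^ 2)) * (-1 : ℝ) ^ SigK a *
      (√(FK a : ℝ))⁻¹ * √(∏ j, (Nat.factorial (t j) : ℝ)) *
      (Matrix.of fun i j : Fin ℓ => (Nat.choose (a i) (t j) : ℝ) *
        (r / (Real.sqrt 2 * σ)) ^ (a i - t j)).det := by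
  have h1 : (Matrix.of fun i j : Fin ℓ => Wrs r σ (a i) (t j)) =
    Matrix.of fun i j => (Real.exp (-r ^ 2 / (8 * σ ^ 2)) * (-1 : ℝ) ^ (a i) *
      (√(Nat.factorial (a i) : ℝ))⁻¹) *
      (Matrix.of fun i j => √(Nat.factorial (t j) : ℝ) * (Matrix.of fun i j : Fin ℓ =>
        (Nat.choose (a i) (t j) : ℝ) * (r / (Real.sqrt 2 * σ)) ^ (a i - t j)) i j) i j := by
    ext i j
    simp only [Matrix.of_apply, Wrs]
    rw [Real.sqrt_div (by positivity)]
    ring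
  rw [h1, Matrix.det_mul_column, Matrix.det_mul_row, Finset.prod_mul_distrib,
    Finset.prod_mul_distrib, Finset.prod_pow_eq_pow_sum, Finset.prod_const, ← Real.exp_nat_mul,
    Finset.prod_inv_distrib, ← Real.sqrt_prod _ (by intros; positivity),
    ← Real.sqrt_prod _ (by intros; positivity)]
  simp only [SigK, FK, Finset.card_univ, Fintype.card_fin]
  push_cast
  rw [show (ℓ : ℝ) * (-r ^ 2 / (8 * σ ^ 2)) = -((ℓ : ℝ) * r ^ 2) / (8 * σ ^ 2) by ring]
  ring

lemma aux_main_s15 (r σ : ℝ) (ℓ : ℕ) (a : Fin ℓ → ℕ) (b : Fin (ℓ + 1)) :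
    (Matrix.of fun i j : Fin ℓ => Wrs r σ (a i) (b.succAbove j)).det =
        Real.exp (-((ℓ : ℝ) * r ^ 2) / (8 * σ ^ 2)) * (-1 : ℝ) ^ SigK a *
          Real.sqrt ((Nat.factorial (b : ℕ) : ℝ) / ((Fbra (ℓ + 1) : ℝ) * (FK a : ℝ))) *
          (r / (Real.sqrt 2 * σ)) ^
            ((SigK a : ℤ) - ((ℓ * (ℓ + 1) / 2 : ℕ) : ℤ) + ((b : ℕ) : ℤ)) *
          CK a * GamR ℓ (fun c => (a c : ℝ)) (b : ℕ) := by
  rw [aux_W r σ a (fun j => (b.succAbove j : ℕ)), aux_pow a (fun j => (b.succAbove j : ℕ)),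
    mul_assoc _ (CK a), ← aux_D, ← aux_choose]
  have hF : (Fbra (ℓ + 1) : ℝ) =
      (Nat.factorial (b : ℕ) : ℝ) * ∏ j, (Nat.factorial (b.succAbove j) : ℝ) := by
    unfold Fbra
    rw [← Fin.prod_univ_eq_prod_range, Fin.prod_univ_succAbove _ b]
    push_cast
    rfl
  have hS : (SigK a : ℤ) - ((ℓ * (ℓ + 1) / 2 : ℕ) : ℤ) + ((b : ℕ) : ℤ) =
      (∑ c, (a c : ℤ)) - ∑ c, ((b.succAbove c : ℕ) : ℤ) := by
    have h1 : ℓ * (ℓ + 1) / 2 = (b : ℕ) + ∑ c, (b.succAbove c : ℕ) := by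
      rw [← Fin.sum_univ_succAbove (fun i : Fin (ℓ + 1) => (i : ℕ)) b,
        Fin.sum_univ_eq_sum_range (fun i => i), Finset.sum_range_id, mul_comm]
      rfl
    rw [h1]
    unfold SigK
    push_cast
    ring
  have hP : (0 : ℝ) < ∏ j, (Nat.factorial (b.succAbove j) : ℝ) :=
    Finset.prod_pos fun _ _ => by positivity
  have hb : (0 : ℝ) < (Nat.factorial (b : ℕ) : ℝ) := by positivity
  rw [hF, hS]
  set P := ∏ j, (Nat.factorial (b.succAbove j) : ℝ)
  rw [show (Nat.factorial (b : ℕ) : ℝ) / ((Nat.factorial (b : ℕ) : ℝ) * P * (FK a : ℝ)) =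
    (P * (FK a : ℝ))⁻¹ by field_simp, Real.sqrt_inv, Real.sqrt_mul hP.le, mul_inv]
  have hs : √P = (√P)⁻¹ * P := by
    have := Real.sqrt_pos.2 hP
    field_simp
    exact Real.sq_sqrt hP.le
  generalize (√P)⁻¹ = q at hs ⊢
  rw [hs]
  ring

/-- Lemma 37. Exact determinant formula for the submatrices
`(W_{r,σ})_{K, [ℓ+1]\{b}}` (columns `[ℓ+1] \ {b}` enumerated increasingly via
`b.succAbove`), and in particular for `(W_{r,σ})_{K,[ℓ]}`. -/
theorem stmt15 (r σ : ℝ) (hσ : 0 < σ) (ℓ : ℕ) (hℓ : 1 ≤ ℓ)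
    (a : Fin ℓ → ℕ) (ha : StrictMono a) (b : Fin (ℓ + 1)) :
    (Matrix.of fun i j : Fin ℓ => Wrs r σ (a i) (b.succAbove j)).det =
        Real.exp (-((ℓ : ℝ) * r ^ 2) / (8 * σ ^ 2)) * (-1 : ℝ) ^ SigK a *
          Real.sqrt ((Nat.factorial (b : ℕ) : ℝ) / ((Fbra (ℓ + 1) : ℝ) * (FK a : ℝ))) *
          (r / (Real.sqrt 2 * σ)) ^
            ((SigK a : ℤ) - ((ℓ * (ℓ + 1) / 2 : ℕ) : ℤ) + ((b : ℕ) : ℤ)) *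
          CK a * GamR ℓ (fun c => (a c : ℝ)) (b : ℕ) ∧
    (Matrix.of fun i j : Fin ℓ => Wrs r σ (a i) (j : ℕ)).det =
        Real.exp (-((ℓ : ℝ) * r ^ 2) / (8 * σ ^ 2)) * (-1 : ℝ) ^ SigK a *
          Real.sqrt (1 / ((Fbra ℓ : ℝ) * (FK a : ℝ))) *
          (r / (Real.sqrt 2 * σ)) ^ ((SigK a : ℤ) - ((ℓ * (ℓ - 1) / 2 : ℕ) : ℤ)) *
          CK a * GamR ℓ (fun c => (a c : ℝ)) ℓ := by
  refine ⟨aux_main_s15 r σ ℓ a b, ?_⟩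
  have h := aux_main_s15 r σ ℓ a (Fin.last ℓ)
  simp only [Fin.succAbove_last, Fin.val_castSucc, Fin.val_last] at h
  rw [h]
  have hF : (Fbra (ℓ + 1) : ℝ) = (Fbra ℓ : ℝ) * (Nat.factorial ℓ : ℝ) := by
    unfold Fbra
    rw [Finset.prod_range_succ]
    push_cast
    rfl
  have h1 : ℓ * (ℓ + 1) / 2 = ℓ * (ℓ - 1) / 2 + ℓ := by
    obtain ⟨k, rfl⟩ := Nat.exists_eq_add_of_le hℓ
    rw [show (1 + k) * (1 + k + 1) = (1 + k) * (1 + k - 1) + (1 + k) * 2 by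
      rw [Nat.add_sub_cancel_left]; ring]
    omega
  have hb : (Nat.factorial ℓ : ℝ) ≠ 0 := by positivity
  rw [hF, h1, show (Nat.factorial ℓ : ℝ) / ((Fbra ℓ : ℝ) * (Nat.factorial ℓ : ℝ) * (FK a : ℝ)) =
    1 / ((Fbra ℓ : ℝ) * (FK a : ℝ)) by
      rw [mul_right_comm, div_mul_cancel_right₀ hb, one_div]]
  push_cast
  congr 4
  ring
end

section
/- Let K ≥ 2, let α_1, …, α_K ∈ [A, 1] for some constant 0 < A < 1/K, and let 0 < w̲ < 1/K². Let μ be the probability measure on the simplex Δ^{K−1} whose density with respect to Lebesgue measure on the coordinates (w_1,…,w_{K−1}) is proportional to Π_{k=1}^K w_k^{α_k−1} · Π_{k=1}^K 1{w_k ∈ [w̲, (1−w̲)/(K−1)]}, where w_K = 1 − Σ_{k=1}^{K−1} w_k. Then there exists a constant C > 0 depending only on w̲, (α_1,…,α_K) and K such that for every point (w_{10},…,w_{K0}) ∈ Δ^{K−1} with w_{k0} ∈ [w̲, (1−w̲)/(K−1)] for all k, and every 0 < ε ≤ 1/(K√(K−1)): μ({(w_1,…,w_K) : Σ_{k=1}^K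 |w_k − w_{k0}| ≤ 2ε}) ≥ C · exp(−2(K−1) log(1/ε)) = C ε^{2(K−1)}. -/
open MeasureTheory

/-- The full weight vector on `Fin (m+1)` obtained from the first `m` coordinates:
`w_k = v_k` for `k < m` and `w_m = 1 − Σ v`. -/
noncomputable def wfull (m : ℕ) (v : Fin m → ℝ) : Fin (m + 1) → ℝ :=
  Fin.snoc v (1 - ∑ c, v c)

/-- Unnormalized density (w.r.t. Lebesgue measure on the first `m` coordinates) of the
Dirichlet distribution with parameters `α`, truncated so that every coordinate of the
full weight vector lies in `[w̲, (1−w̲)/m]`. -/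
noncomputable def trDirDens (m : ℕ) (α : Fin (m + 1) → ℝ) (wlow : ℝ)
    (v : Fin m → ℝ) : ℝ :=
  (∏ k : Fin (m + 1), wfull m v k ^ (α k - 1)) *
    Set.indicator {v : Fin m → ℝ |
        ∀ k : Fin (m + 1), wfull m v k ∈ Set.Icc wlow ((1 - wlow) / m)}
      (fun _ => (1 : ℝ)) v

theorem wfull_aux (m : ℕ) (w0 : Fin (m + 1) → ℝ) (h : ∑ k, w0 k = 1) (t : ℝ) (v : Fin m → ℝ)
    (k : Fin (m + 1)) :
    wfull m (AffineMap.homothety (fun i : Fin m => w0 i.castSucc) t v) k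
      = w0 k + t * (wfull m v k - w0 k) := by
  rw [Fin.sum_univ_castSucc] at h
  refine Fin.lastCases ?_ (fun i => ?_) k
  · simp only [wfull, Fin.snoc_last, AffineMap.homothety_apply, vsub_eq_sub, vadd_eq_add,
      Pi.add_apply, Pi.smul_apply, Pi.sub_apply, smul_eq_mul, Finset.sum_add_distrib,
      ← Finset.mul_sum, Finset.sum_sub_distrib]
    linear_combination (t - 1) * h
  · simp only [wfull, Fin.snoc_castSucc, AffineMap.homothety_apply, vsub_eq_sub, vadd_eq_add,
      Pi.add_apply, Pi.smul_apply, Pi.sub_apply, smul_eq_mul]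
    ring

theorem wfull_sum (m : ℕ) (v : Fin m → ℝ) : ∑ k, wfull m v k = 1 := by
  simp [Fin.sum_univ_castSucc, wfull]

theorem wfull_cont (m : ℕ) (k : Fin (m + 1)) : Continuous (fun v => wfull m v k) := by
  refine Fin.lastCases ?_ (fun i => ?_) k
  · simp only [wfull, Fin.snoc_last]; fun_prop
  · simp only [wfull, Fin.snoc_castSucc]; fun_prop

/-- prior concentration of the truncated Dirichlet distribution.
With `K = m + 1 ≥ 2` components, parameters `α_k ∈ [A, 1]`, `0 < A < 1/K`, truncation
level `0 < w̲ < 1/K²`, and positive normalizer, there is `C > 0` (depending only on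
`w̲`, `α` and `K`) such that the truncated Dirichlet measure of the `L¹`-ball of radius
`2ε` around any admissible `w₀` is at least `C ε^{2(K−1)}`. -/
theorem stmt19 (m : ℕ) (hm : 1 ≤ m) (A : ℝ) (α : Fin (m + 1) → ℝ)
    (hA : 0 < A) (hA' : A < 1 / (m + 1)) (hα : ∀ k, α k ∈ Set.Icc A 1)
    (wlow : ℝ) (hw : 0 < wlow) (hw' : wlow < 1 / ((m : ℝ) + 1) ^ 2)
    (hpos : 0 < ∫ v : Fin m → ℝ, trDirDens m α wlow v) :
    ∃ C > (0 : ℝ), ∀ w0 : Fin (m + 1) → ℝ,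
      (∑ k, w0 k = 1) → (∀ k, w0 k ∈ Set.Icc wlow ((1 - wlow) / m)) →
      ∀ ε : ℝ, 0 < ε → ε ≤ 1 / (((m : ℝ) + 1) * Real.sqrt m) →
        C * ε ^ (2 * m) * (∫ v : Fin m → ℝ, trDirDens m α wlow v) ≤
          ∫ v in {v : Fin m → ℝ | ∑ k, |wfull m v k - w0 k| ≤ 2 * ε},
            trDirDens m α wlow v := by
  classical
  have hm1 : (1 : ℝ) ≤ m := by exact_mod_cast hm
  have hw1 : wlow ≤ 1 := by
    refine hw'.le.trans ?_
    rw [div_le_one (by positivity)]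
    nlinarith
  have hup : (1 - wlow) / m ≤ 1 := by
    rw [div_le_one (by positivity)]; linarith
  set S : Set (Fin m → ℝ) := {v : Fin m → ℝ |
        ∀ k : Fin (m + 1), wfull m v k ∈ Set.Icc wlow ((1 - wlow) / m)} with hS
  have hSmeas : MeasurableSet S := by
    have : S = ⋂ k, (fun v => wfull m v k) ⁻¹' Set.Icc wlow ((1 - wlow) / m) := by
      ext v; simp [hS]
    rw [this]
    exact MeasurableSet.iInter fun k => (wfull_cont m k).measurable measurableSet_Icc
  have hSsub : S ⊆ Set.Icc (fun _ => (0 : ℝ)) (fun _ => 1) := by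
    intro v hv
    have hk : ∀ i : Fin m, 0 ≤ v i ∧ v i ≤ 1 := by
      intro i
      have := hv i.castSucc
      simp only [wfull, Fin.snoc_castSucc, Set.mem_Icc] at this
      exact ⟨by linarith, by linarith⟩
    exact ⟨fun i => (hk i).1, fun i => (hk i).2⟩
  have hSfin : volume S < ⊤ :=
    (measure_mono hSsub).trans_lt isCompact_Icc.measure_lt_top
  set M : ℝ := ∏ k, wlow ^ (α k - 1) with hM
  have hMpos : 0 < M := Finset.prod_pos fun k _ => Real.rpow_pos_of_pos hw _
  have hle : ∀ v, trDirDens m α wlow v ≤ S.indicator (fun _ => M) v := by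
    intro v
    unfold trDirDens
    rw [← hS]
    by_cases hv : v ∈ S
    · simp only [Set.indicator_of_mem hv, mul_one]
      refine Finset.prod_le_prod (fun k _ => Real.rpow_nonneg (hw.le.trans (hv k).1) _) ?_
      intro k _
      exact Real.rpow_le_rpow_of_nonpos hw (hv k).1 (by linarith [(hα k).2])
    · simp [Set.indicator_of_notMem hv]
  have hge : ∀ v, S.indicator (fun _ => (1 : ℝ)) v ≤ trDirDens m α wlow v := by
    intro v
    unfold trDirDens
    rw [← hS]
    by_cases hv : v ∈ S
    · simp only [Set.indicator_of_mem hv, mul_one]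
      refine (Finset.prod_const_one (s := (Finset.univ : Finset (Fin (m + 1))))).symm.le.trans ?_
      refine Finset.prod_le_prod (fun _ _ => zero_le_one) ?_
      intro k _
      exact Real.one_le_rpow_of_pos_of_le_one_of_nonpos (hw.trans_le (hv k).1)
        ((hv k).2.trans hup) (by linarith [(hα k).2])
    · simp [Set.indicator_of_notMem hv]
  have hint : Integrable (fun v => trDirDens m α wlow v) := by
    by_contra h
    rw [integral_undef h] at hpos
    exact lt_irrefl _ hpos
  have hI : ∫ v, trDirDens m α wlow v ≤ M * volume.real S := by
    calc _ ≤ ∫ v, S.indicator (fun _ => M) v :=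
          integral_mono hint ((integrable_indicator_iff hSmeas).2
            (integrableOn_const hSfin.ne)) hle
      _ = _ := by
          rw [integral_indicator hSmeas]; simp [mul_comm]
  refine ⟨1 / M, by positivity, ?_⟩
  intro w0 hsum hw0 ε hε hε1
  have hε1' : ε ≤ 1 := by
    refine hε1.trans ?_
    have h1 : 1 ≤ Real.sqrt m := Real.one_le_sqrt.2 hm1
    rw [div_le_one (by positivity)]
    nlinarith
  set B : Set (Fin m → ℝ) := {v : Fin m → ℝ | ∑ k, |wfull m v k - w0 k| ≤ 2 * ε} with hB
  have hBmeas : MeasurableSet B := by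
    refine measurableSet_le (Finset.measurable_sum _ fun k _ => ?_) measurable_const
    exact (((wfull_cont m k).sub continuous_const).abs).measurable
  set φ := AffineMap.homothety (fun i : Fin m => w0 i.castSucc) ε with hφ
  have hsubB : φ '' S ⊆ S ∩ B := by
    rintro _ ⟨v, hv, rfl⟩
    refine ⟨fun k => ?_, ?_⟩
    · rw [hφ, wfull_aux m w0 hsum]
      have h1 := hv k
      have h2 := hw0 k
      simp only [Set.mem_Icc] at h1 h2 ⊢
      constructor <;> nlinarith
    · change ∑ k, |wfull m (φ v) k - w0 k| ≤ 2 * ε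
      have : ∀ k, |wfull m (φ v) k - w0 k| ≤ ε * (wfull m v k + w0 k) := by
        intro k
        rw [hφ, wfull_aux m w0 hsum, add_sub_cancel_left, abs_mul, abs_of_pos hε]
        refine mul_le_mul_of_nonneg_left ?_ hε.le
        have h1 := (hv k).1
        have h2 := (hw0 k).1
        rw [abs_le]; constructor <;> linarith
      refine (Finset.sum_le_sum fun k _ => this k).trans ?_
      rw [← Finset.mul_sum, Finset.sum_add_distrib, wfull_sum, hsum]
      linarith
  have hvol : volume.real (φ '' S) = ε ^ m * volume.real S := by
    rw [hφ, Measure.real, Measure.addHaar_image_homothety]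
    simp [Measure.real, abs_of_pos hε, hε.le]
  have hSBmeas : MeasurableSet (S ∩ B) := hSmeas.inter hBmeas
  have hSBfin : volume (S ∩ B) < ⊤ := (measure_mono Set.inter_subset_left).trans_lt hSfin
  have hlow : volume.real (S ∩ B) ≤ ∫ v in B, trDirDens m α wlow v := by
    calc volume.real (S ∩ B) = ∫ v in B, S.indicator (fun _ => (1 : ℝ)) v := by
          rw [integral_indicator hSmeas, Measure.restrict_restrict hSmeas]; simp
      _ ≤ _ := integral_mono (((integrable_indicator_iff hSmeas).2
            (integrableOn_const hSfin.ne)).integrableOn) hint.integrableOn hge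
  refine le_trans ?_ hlow
  refine le_trans ?_ (measureReal_mono hsubB hSBfin.ne)
  rw [hvol]
  have hpow : ε ^ (2 * m) ≤ ε ^ m := pow_le_pow_of_le_one hε.le hε1' (by omega)
  calc 1 / M * ε ^ (2 * m) * ∫ v, trDirDens m α wlow v
      ≤ 1 / M * ε ^ m * (M * volume.real S) := by gcongr
    _ = _ := by field_simp
end
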